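/- arXiv:2104.03385 — 4 statements merged into one kernel-verified Lean document; each statement's English description precedes it below -/
import Mathlib

section
/- Let k be a field of characteristic zero, R = k[x_1,…,x_n], and let p be a prime ideal of R of height c such that {x_{c+1},…,x_n} is a basis modulo p. Let U ⊆ R^r be a p-primary R-submodule of multiplicity m over p. Then there exist m differential operators δ_1,…,δ_m ∈ D_{n,c}^r (involving only ∂_{x_1},…,∂_{x_c}) such that U = {w ∈ R^r | δ_i(w) ∈ p for all 1 ≤ i ≤ m}; that is, U admits a set of m Noetherian operators in the relative Weyl algebra. -/
set_option maxHeartbeats 1000000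
set_option synthInstance.maxHeartbeats 400000

open MvPolynomial

section DiffOps

variable {n : ℕ} {k : Type*} [CommSemiring k]

/-- The iterated partial derivative `∂^α = ∂^{|α|}/∂x_1^{α_1}⋯∂x_n^{α_n}` on
`R = k[x_1,…,x_n]`, as a `k`-linear endomorphism. -/
noncomputable def derivOp (α : Fin n →₀ ℕ) : Module.End k (MvPolynomial (Fin n) k) :=
  (List.ofFn fun i : Fin n =>
    ((MvPolynomial.pderiv i).toLinearMap : Module.End k (MvPolynomial (Fin n) k)) ^ (α i)).prod

/-- A differential operator `δ ∈ D_n^r`, encoded by a finitely supported family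
`(c_{j,α})` of polynomials. -/
abbrev DiffOp (n : ℕ) (k : Type*) [CommSemiring k] (r : ℕ) :=
  Fin r → ((Fin n →₀ ℕ) →₀ MvPolynomial (Fin n) k)

/-- The `k`-linear action of `δ ∈ D_n^r` on `R^r`: `δ(w) = Σ_{j,α} c_{j,α}·∂^α w_j`. -/
noncomputable def DiffOp.act {r : ℕ} (δ : DiffOp n k r) :
    (Fin r → MvPolynomial (Fin n) k) →ₗ[k] MvPolynomial (Fin n) k :=
  ∑ j : Fin r, (δ j).sum fun α cα =>
    cα • ((derivOp α).comp
      (LinearMap.proj j : (Fin r → MvPolynomial (Fin n) k) →ₗ[k] MvPolynomial (Fin n) k))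

/-- `δ` lies in `D_{n,c}^r`, i.e. involves only `∂_{x_1},…,∂_{x_c}`:
`c_{j,α} = 0` whenever `α_i ≠ 0` for some `i > c`. -/
def DiffOp.InRelWeyl {r : ℕ} (c : ℕ) (δ : DiffOp n k r) : Prop :=
  ∀ j : Fin r, ∀ α ∈ (δ j).support, ∀ i : Fin n, c ≤ (i : ℕ) → α i = 0

end DiffOps

section Mult

variable {R : Type*} [CommRing R]

/-- The multiplicity of a submodule `U ⊆ M` over a prime `p`: the length of the
`R_p`-module `M_p/U_p ≅ (M/U)_p`, expressed as the Krull dimension of the lattice of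
`R_p`-submodules. -/
noncomputable def multOver (p : Ideal R) [p.IsPrime] {M : Type*} [AddCommGroup M]
    [Module R M] (U : Submodule R M) : WithBot ℕ∞ :=
  Order.krullDim (Submodule (Localization.AtPrime p) (LocalizedModule p.primeCompl (M ⧸ U)))

/-- `U ⊆ M` is a `p`-primary submodule: `Ass_R(M/U) = {p}`. -/
def IsPrimarySubmodule (p : Ideal R) {M : Type*} [AddCommGroup M] [Module R M]
    (U : Submodule R M) : Prop :=
  associatedPrimes R (M ⧸ U) = {p}

end Mult

lemma pderiv_pow_monomial {n : ℕ} {k : Type*} [CommSemiring k] (i : Fin n) (a : ℕ)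
    (β : Fin n →₀ ℕ) (z : k) :
    (((MvPolynomial.pderiv i).toLinearMap : Module.End k (MvPolynomial (Fin n) k)) ^ a)
      (monomial β z) = monomial (β - Finsupp.single i a) (z * ((β i).descFactorial a : ℕ)) := by
  induction a with
  | zero => simp
  | succ a ih =>
    rw [pow_succ', Module.End.mul_apply, ih]
    simp only [Derivation.coeFn_coe, pderiv_monomial]
    congr 1
    · congr 1
      ext j
      by_cases h : j = i
      · subst h; simp; omega
      · simp [Ne.symm h]
    · simp [Nat.descFactorial_succ]
      ring

lemma list_deriv_monomial {n : ℕ} {k : Type*} [CommSemiring k] (α β : Fin n →₀ ℕ)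
    (l : List (Fin n)) (hl : l.Nodup) :
    ((l.map fun i => ((MvPolynomial.pderiv i).toLinearMap :
      Module.End k (MvPolynomial (Fin n) k)) ^ (α i)).prod) (monomial β 1) =
      monomial (β - (l.map fun i => Finsupp.single i (α i)).sum)
        ((l.map fun i => (((β i).descFactorial (α i) : ℕ) : k)).prod) := by
  induction l with
  | nil => simp
  | cons i l ih =>
    rw [List.nodup_cons] at hl
    rw [List.map_cons, List.prod_cons, Module.End.mul_apply, ih hl.2, pderiv_pow_monomial]
    have h0 : ∀ l : List (Fin n), i ∉ l →
        ((l.map fun i => Finsupp.single i (α i)).sum) i = 0 := by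
      intro l
      induction l with
      | nil => simp
      | cons j l ih =>
        intro h
        rw [List.mem_cons, not_or] at h
        simp [ih h.2, Ne.symm h.1]
    have := h0 l hl.1
    congr 1
    · congr 1
      ext j
      simp
      omega
    · simp only [Finsupp.coe_tsub, Pi.sub_apply, this, tsub_zero, List.map_cons, List.prod_cons]
      ring

lemma derivOp_monomial {n : ℕ} {k : Type*} [CommSemiring k] (α β : Fin n →₀ ℕ) :
    derivOp α (monomial β (1 : k)) =
      monomial (β - α) (∏ i, (((β i).descFactorial (α i) : ℕ) : k)) := by
  unfold derivOp
  rw [List.ofFn_eq_map, list_deriv_monomial _ _ _ (List.nodup_finRange n)]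
  rw [← List.ofFn_eq_map, List.sum_ofFn, ← List.ofFn_eq_map, List.prod_ofFn,
    Finsupp.univ_sum_single α]

lemma add_pow_nilp {Q : Type*} [CommRing Q] (u y : Q) (N b : ℕ) (hy : y ^ N = 0) :
    (y + u) ^ b = ∑ a ∈ Finset.range N, y ^ a * u ^ (b - a) * (b.choose a : ℕ) := by
  rw [add_pow]
  have h1 : ∑ a ∈ Finset.range (b + 1), y ^ a * u ^ (b - a) * (b.choose a : ℕ) =
      ∑ a ∈ Finset.range (max N (b + 1)), y ^ a * u ^ (b - a) * (b.choose a : ℕ) := by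
    apply Finset.sum_subset
    · intro x; simp; omega
    · intro x _ hx
      rw [Nat.choose_eq_zero_of_lt (by simpa using hx)]
      simp
  rw [h1]
  symm
  apply Finset.sum_subset
  · intro x; simp; omega
  · intro x _ hx
    rw [pow_eq_zero_of_le (by simpa using hx) hy]
    simp

/-- Taylor's formula. -/
lemma taylor {n : ℕ} {k κ Q : Type*} [Field k] [CharZero k] [Field κ] [Algebra k κ] [CommRing Q]
    [Algebra k Q] (ι : MvPolynomial (Fin n) k →ₐ[k] Q) (res : MvPolynomial (Fin n) k →ₐ[k] κ)
    (σ : κ →ₐ[k] Q) (N : ℕ) (hN : ∀ i, (ι (X i) - σ (res (X i))) ^ N = 0)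
    (w : MvPolynomial (Fin n) k) :
    ι w = ∑ a ∈ Fintype.piFinset (fun _ : Fin n => Finset.range N),
      σ (res (derivOp (Finsupp.equivFunOnFinite.symm a) w) *
          (algebraMap k κ (∏ i, ((a i).factorial : k))⁻¹)) *
        ∏ i, (ι (X i) - σ (res (X i))) ^ (a i) := by
  induction w using MvPolynomial.induction_on' with
  | add p q hp hq =>
    rw [map_add, hp, hq, ← Finset.sum_add_distrib]
    refine Finset.sum_congr rfl fun a _ => ?_
    simp only [map_add, add_mul]
  | monomial β z =>
    have hz : monomial β z = z • monomial β (1 : k) := by simp [smul_monomial]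
    suffices H : ι (monomial β 1) = ∑ a ∈ Fintype.piFinset (fun _ : Fin n => Finset.range N),
      σ (res (derivOp (Finsupp.equivFunOnFinite.symm a) (monomial β 1)) *
          (algebraMap k κ (∏ i, ((a i).factorial : k))⁻¹)) *
        ∏ i, (ι (X i) - σ (res (X i))) ^ (a i) by
      rw [hz, map_smul, H, Finset.smul_sum]
      refine Finset.sum_congr rfl fun a _ => ?_
      simp only [map_smul, smul_mul_assoc]
    have hmon : ∀ γ : Fin n →₀ ℕ, monomial γ (1 : k) = ∏ i, X i ^ γ i := by
      intro γ
      rw [monomial_eq, Finsupp.prod_fintype _ _ (by simp)]; simp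
    have h1 : ι (monomial β 1) =
        ∏ i, ((ι (X i) - σ (res (X i))) + σ (res (X i))) ^ β i := by
      rw [hmon]; simp
    rw [h1, Finset.prod_congr rfl (fun i _ => add_pow_nilp (σ (res (X i))) _ N (β i) (hN i)),
      Finset.prod_univ_sum]
    refine Finset.sum_congr rfl fun a _ => ?_
    rw [derivOp_monomial]
    have h2 : ∀ z : k, (monomial (β - Finsupp.equivFunOnFinite.symm a) z : MvPolynomial (Fin n) k) =
        z • ∏ i, X i ^ (β i - a i) := by
      intro z
      rw [← mul_one z, ← smul_eq_mul, ← smul_monomial, hmon]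
      simp
    rw [h2, map_smul, Algebra.smul_def, mul_right_comm, ← map_mul (algebraMap k κ), map_mul σ,
      AlgHom.commutes, ← Finset.prod_inv_distrib, ← Finset.prod_mul_distrib]
    have h3 : ∀ i, (((β i).descFactorial (a i) : ℕ) : k) * ((a i).factorial : k)⁻¹ =
        ((β i).choose (a i) : ℕ) := by
      intro i
      rw [Nat.descFactorial_eq_factorial_mul_choose]
      have : ((a i).factorial : k) ≠ 0 := by exact_mod_cast (a i).factorial_ne_zero
      push_cast
      field_simp
    simp only [Finsupp.equivFunOnFinite_symm_apply_apply, h3, map_prod, map_pow, map_natCast,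
      ← Finset.prod_mul_distrib]
    refine Finset.prod_congr rfl fun i _ => ?_
    ring

lemma isMaximal_of_height {T : Type*} [CommRing T] (P : Ideal T) [P.IsPrime] (d : ℕ)
    (hT : ringKrullDim T ≤ d) (hP : P.height = d) : P.IsMaximal := by
  obtain ⟨M, hM, hPM⟩ := P.exists_le_maximal (Ideal.IsPrime.ne_top inferInstance)
  rcases hPM.eq_or_lt with h | h
  · rwa [h]
  · exfalso
    have : P.FiniteHeight := ⟨Or.inr (by rw [hP]; exact ENat.natCast_ne_top d)⟩
    have h1 := Ideal.height_strict_mono_of_isPrime h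
    have h2 := (Ideal.height_le_ringKrullDim_of_ne_top hM.ne_top).trans hT
    have h3 : M.height ≤ d := by exact_mod_cast h2
    rw [hP] at h1
    exact absurd h1 (not_lt.mpr h3)

lemma alg_of_height {s A κ : Type*} [Finite s] [CommRing A] [IsDomain A] [IsNoetherianRing A]
    [Field κ] [Algebra A κ] [FaithfulSMul A κ] (ξ : s → κ)
    (h : (RingHom.ker (aeval ξ : MvPolynomial s A →ₐ[A] κ)).height = (Nat.card s : ℕ)) (i : s) :
    let := FractionRing.liftAlgebra A κ
    IsAlgebraic (FractionRing A) (ξ i) := by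
  let := FractionRing.liftAlgebra A κ
  let K := FractionRing A
  let φ : MvPolynomial s K →ₐ[K] κ := aeval ξ
  let P : Ideal (MvPolynomial s K) := RingHom.ker φ
  have : P.IsPrime := RingHom.ker_isPrime _
  let : Algebra (MvPolynomial s A) (MvPolynomial s K) := MvPolynomial.algebraMvPolynomial
  have hu : P.under (MvPolynomial s A) = RingHom.ker (aeval ξ : MvPolynomial s A →ₐ[A] κ) := by
    ext f
    simp only [P, φ, Ideal.mem_comap, RingHom.mem_ker, Ideal.under]
    have : aeval ξ (algebraMap (MvPolynomial s A) (MvPolynomial s K) f) = aeval ξ f := by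
      rw [MvPolynomial.algebraMap_def]
      exact MvPolynomial.aeval_map_algebraMap K ξ f
    rw [this]
  have hh : P.height = (Nat.card s : ℕ) := by
    rw [← IsLocalization.height_under ((nonZeroDivisors A).map (C (σ := s))) P, hu, h]
  have hd : ringKrullDim (MvPolynomial s K) ≤ (Nat.card s : ℕ) := by
    rw [MvPolynomial.ringKrullDim_of_isNoetherianRing, ringKrullDim_eq_zero_of_field, zero_add]
  have hmax := isMaximal_of_height P _ hd hh
  let : Field (MvPolynomial s K ⧸ P) := Ideal.Quotient.field P
  have : Module.Finite K (MvPolynomial s K ⧸ P) :=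
    finite_of_finite_type_of_isJacobsonRing K (MvPolynomial s K ⧸ P)
  have hi : IsAlgebraic K (Ideal.Quotient.mkₐ K P (X i)) := Algebra.IsAlgebraic.isAlgebraic _
  have := hi.algHom (Ideal.Quotient.liftₐ P φ (fun a ha => RingHom.mem_ker.mp ha))
  have h2 : Ideal.Quotient.liftₐ P φ (fun a ha => RingHom.mem_ker.mp ha)
      (Ideal.Quotient.mkₐ K P (X i)) = ξ i := aeval_X ξ i
  rw [h2] at this
  exact this

lemma length_eq_of_residue {κ Q V : Type*} [Field κ] [CommRing Q] [IsLocalRing Q] [Algebra κ Q]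
    [AddCommGroup V] [Module κ V] [Module Q V] [IsScalarTower κ Q V]
    (h : Function.Surjective (algebraMap κ (IsLocalRing.ResidueField Q))) :
    Module.length κ V = Module.length Q V := by
  have : IsLocalHom (algebraMap κ Q) := inferInstance
  rw [IsLocalRing.length_restrictScalars κ Q V, Module.length_eq_of_surjective
    (R := IsLocalRing.ResidueField Q) (M := IsLocalRing.ResidueField Q),
    Module.length_eq_one (IsLocalRing.ResidueField Q), mul_one]
  intro x
  obtain ⟨a, rfl⟩ := h x
  exact ⟨IsLocalRing.residue κ a, rfl⟩

lemma nilp_of_length {S V : Type*} [CommRing S] [IsLocalRing S] [AddCommGroup V] [Module S V]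
    (h : Module.length S V ≠ ⊤) :
    ∃ N : ℕ, ∀ s ∈ (IsLocalRing.maximalIdeal S) ^ N, ∀ v : V, s • v = 0 := by
  rw [Module.length_ne_top_iff, isFiniteLength_iff_isNoetherian_isArtinian] at h
  obtain ⟨_, _⟩ := h
  let f : ℕ →o (Submodule S V)ᵒᵈ :=
    ⟨fun N => OrderDual.toDual ((IsLocalRing.maximalIdeal S) ^ N • (⊤ : Submodule S V)),
     fun a b hab => Submodule.smul_mono_left (Ideal.pow_le_pow_right hab)⟩
  obtain ⟨N, hN⟩ := IsArtinian.monotone_stabilizes f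
  refine ⟨N, fun s hs v => ?_⟩
  have h1 : (IsLocalRing.maximalIdeal S) ^ N • (⊤ : Submodule S V) =
      (IsLocalRing.maximalIdeal S) ^ (N + 1) • (⊤ : Submodule S V) := hN (N + 1) (by omega)
  have h2 : (IsLocalRing.maximalIdeal S) ^ N • (⊤ : Submodule S V) = ⊥ := by
    apply Submodule.eq_bot_of_le_smul_of_le_jacobson_bot (IsLocalRing.maximalIdeal S) _
      (IsNoetherian.noetherian _)
    · conv_lhs => rw [h1, pow_succ', Submodule.mul_smul]
    · exact (IsLocalRing.maximalIdeal_le_jacobson _)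
  have := Submodule.smul_mem_smul hs (Submodule.mem_top (x := v))
  rw [h2] at this
  simpa using this

lemma formallySmooth_of_height {n c : ℕ} {k κ : Type*} [Field k] [CharZero k] [Field κ]
    (hc : c ≤ n)
    [Algebra k κ] [Algebra (MvPolynomial (Fin n) k) κ] [IsScalarTower k (MvPolynomial (Fin n) k) κ]
    [Algebra (MvPolynomial {i : Fin n // c ≤ (i : ℕ)} k) κ]
    [IsScalarTower k (MvPolynomial {i : Fin n // c ≤ (i : ℕ)} k) κ]
    (hA : ∀ i, algebraMap (MvPolynomial {i : Fin n // c ≤ (i : ℕ)} k) κ (X i) =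
      algebraMap (MvPolynomial (Fin n) k) κ (X i.1))
    (hinj : Function.Injective (algebraMap (MvPolynomial {i : Fin n // c ≤ (i : ℕ)} k) κ))
    (hfrac : ∀ z : κ, ∃ f g, z = algebraMap (MvPolynomial (Fin n) k) κ f /
      algebraMap (MvPolynomial (Fin n) k) κ g)
    (hht : (RingHom.ker (algebraMap (MvPolynomial (Fin n) k) κ)).height = c) :
    Algebra.FormallySmooth (MvPolynomial {i : Fin n // c ≤ (i : ℕ)} k) κ := by
  let A := MvPolynomial {i : Fin n // c ≤ (i : ℕ)} k
  let s := {i : Fin n // ¬ c ≤ (i : ℕ)}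
  have : FaithfulSMul A κ := (faithfulSMul_iff_algebraMap_injective A κ).mpr hinj
  let := FractionRing.liftAlgebra A κ
  have htower : IsScalarTower A (FractionRing A) κ := inferInstance
  let ξ : s → κ := fun i => algebraMap (MvPolynomial (Fin n) k) κ (X i.1)
  let e : MvPolynomial (Fin n) k ≃ₐ[k] MvPolynomial s A :=
    (renameEquiv k ((Equiv.sumComm _ _).trans (Equiv.sumCompl fun i : Fin n => c ≤ (i : ℕ)))).symm.trans
      (sumAlgEquiv k s {i : Fin n // c ≤ (i : ℕ)})
  have hs : Nat.card s = c := by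
    rw [Nat.card_eq_fintype_card, Fintype.card_subtype]
    simp only [not_le]
    simpa [hc] using Fin.card_filter_val_lt (n := n) (m := c)
  have hcomp : ∀ f, aeval ξ (e f) = algebraMap (MvPolynomial (Fin n) k) κ f := by
    have : ((aeval ξ : MvPolynomial s A →ₐ[A] κ).restrictScalars k).comp e.toAlgHom =
        IsScalarTower.toAlgHom k (MvPolynomial (Fin n) k) κ := by
      apply MvPolynomial.algHom_ext
      intro i
      by_cases hi : c ≤ (i : ℕ)
      · have : (Equiv.sumCompl fun i : Fin n => c ≤ (i : ℕ)).symm i = Sum.inl ⟨i, hi⟩ :=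
          Equiv.sumCompl_symm_apply_of_pos (p := fun i : Fin n => c ≤ (i : ℕ)) hi
        simp [e, this, hA, A]
      · have : (Equiv.sumCompl fun i : Fin n => c ≤ (i : ℕ)).symm i = Sum.inr ⟨i, hi⟩ :=
          Equiv.sumCompl_symm_apply_of_neg (p := fun i : Fin n => c ≤ (i : ℕ)) hi
        simp [e, this, ξ, A]
    intro f
    exact DFunLike.congr_fun this f
  have hker : (RingHom.ker (aeval ξ : MvPolynomial s A →ₐ[A] κ)).height = (Nat.card s : ℕ) := by
    rw [hs, ← hht, ← RingEquiv.height_comap e.toRingEquiv]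
    congr 1
    ext f
    simp only [Ideal.mem_comap, RingHom.mem_ker]
    rw [← hcomp f]
    rfl
  have halg := alg_of_height ξ hker
  let L := algebraicClosure (FractionRing A) κ
  have hAL : ∀ a : A, algebraMap A κ a ∈ L := fun a => by
    rw [IsScalarTower.algebraMap_apply A (FractionRing A) κ]
    exact L.algebraMap_mem _
  have hL : ∀ f, algebraMap (MvPolynomial (Fin n) k) κ f ∈ L := by
    intro f
    induction f using MvPolynomial.induction_on with
    | C a =>
      have := hAL (C a)
      rw [← MvPolynomial.algebraMap_eq, ← IsScalarTower.algebraMap_apply] at this ⊢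
      exact this
    | add p q hp hq => rw [map_add]; exact add_mem hp hq
    | mul_X p i hp =>
      rw [map_mul]
      refine mul_mem hp ?_
      by_cases hi : c ≤ (i : ℕ)
      · rw [← hA ⟨i, hi⟩]
        exact hAL _
      · exact mem_algebraicClosure_iff.mpr (halg ⟨i, hi⟩)
  have : Algebra.IsAlgebraic (FractionRing A) κ := by
    refine ⟨fun z => ?_⟩
    obtain ⟨f, g, rfl⟩ := hfrac z
    exact mem_algebraicClosure_iff.mp (div_mem (hL f) (hL g))
  have : CharZero (FractionRing A) := by
    have : CharZero A := inferInstanceAs (CharZero (MvPolynomial _ _))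
    exact charZero_of_injective_algebraMap (IsFractionRing.injective A (FractionRing A))
  have : Algebra.FormallySmooth A (FractionRing A) := .of_isLocalization (nonZeroDivisors A)
  have : Algebra.FormallyEtale (FractionRing A) κ := .of_isSeparable _ _
  exact .comp A (FractionRing A) κ

lemma core {n c r m : ℕ} {k S V : Type*} [Field k] [CharZero k] [CommRing S] [IsLocalRing S]
    [Algebra k S] [Algebra (MvPolynomial (Fin n) k) S] [IsScalarTower k (MvPolynomial (Fin n) k) S]
    [Algebra (MvPolynomial {i : Fin n // c ≤ (i : ℕ)} k) S]
    [IsScalarTower k (MvPolynomial {i : Fin n // c ≤ (i : ℕ)} k) S]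
    (hA : ∀ i, algebraMap (MvPolynomial {i : Fin n // c ≤ (i : ℕ)} k) S (X i) =
      algebraMap (MvPolynomial (Fin n) k) S (X i.1))
    [Algebra.FormallySmooth (MvPolynomial {i : Fin n // c ≤ (i : ℕ)} k)
      (IsLocalRing.ResidueField S)]
    [AddCommGroup V] [Module S V] (hV : Module.length S V = m) (e : Fin r → V) :
    ∃ (F : Finset (Fin n → ℕ)) (D : Fin m → Fin r → (Fin n → ℕ) → IsLocalRing.ResidueField S),
      (∀ i j a (l : Fin n), c ≤ (l : ℕ) → a l ≠ 0 → D i j a = 0) ∧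
      ∀ w : Fin r → MvPolynomial (Fin n) k,
        (∑ j, algebraMap _ S (w j) • e j = 0) ↔
        ∀ i, ∑ j, ∑ a ∈ F, D i j a * IsLocalRing.residue S
          (algebraMap _ S (derivOp (Finsupp.equivFunOnFinite.symm a) (w j))) = 0 := by
  obtain ⟨N, hN⟩ := nilp_of_length (S := S) (V := V) (by rw [hV]; exact ENat.natCast_ne_top m)
  let κ := IsLocalRing.ResidueField S
  let A := MvPolynomial {i : Fin n // c ≤ (i : ℕ)} k
  let M := IsLocalRing.maximalIdeal S
  -- enlarge the exponent so that it is positive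
  let I : Ideal S := M ^ (N + 1)
  let Q := S ⧸ I
  have hI : I ≤ M := Ideal.pow_le_self (Nat.succ_ne_zero N)
  let g : Q →ₐ[A] κ := Ideal.Quotient.liftₐ I (IsScalarTower.toAlgHom A S κ)
    (fun a ha => (IsLocalRing.residue_eq_zero_iff a).mpr (hI ha))
  have hgmk : ∀ s : S, g (Ideal.Quotient.mk I s) = IsLocalRing.residue S s := fun s => rfl
  have hgs : Function.Surjective g := by
    intro z
    obtain ⟨s, rfl⟩ := IsLocalRing.residue_surjective z
    exact ⟨Ideal.Quotient.mk I s, rfl⟩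
  have hker : ∀ q : Q, g q = 0 → q ∈ M.map (Ideal.Quotient.mk I) := by
    intro q hq
    obtain ⟨s, rfl⟩ := Ideal.Quotient.mk_surjective q
    rw [hgmk, IsLocalRing.residue_eq_zero_iff] at hq
    exact Ideal.mem_map_of_mem _ hq
  have hMN : (M.map (Ideal.Quotient.mk I)) ^ (N + 1) = ⊥ := by
    rw [← Ideal.map_pow]
    exact Ideal.map_quotient_self I
  have hnil : IsNilpotent (RingHom.ker g) := by
    refine ⟨N + 1, ?_⟩
    rw [Ideal.zero_eq_bot, eq_bot_iff, ← hMN]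
    exact Ideal.pow_right_mono (fun q hq => hker q hq) _
  let σ : κ →ₐ[A] Q := Algebra.FormallySmooth.liftOfSurjective (AlgHom.id A κ) g hgs hnil
  have hσ : ∀ z, g (σ z) = z := fun z =>
    Algebra.FormallySmooth.liftOfSurjective_apply (AlgHom.id A κ) g hgs hnil z
  have : Nontrivial Q := Ideal.Quotient.nontrivial_iff.mpr
    (fun h => (IsLocalRing.maximalIdeal.isMaximal S).ne_top (top_le_iff.mp (h ▸ hI)))
  have : IsLocalRing Q := IsLocalRing.of_surjective' _ Ideal.Quotient.mk_surjective
  -- module structures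
  have htors : Module.IsTorsionBySet S V I := by
    rintro v ⟨s, hs⟩
    exact hN s (Ideal.pow_le_pow_right (Nat.le_succ N) hs) v
  let : Module Q V := htors.module
  have hQV : ∀ (s : S) (v : V), (Ideal.Quotient.mk I s : Q) • v = s • v := fun s v => rfl
  have : IsScalarTower S Q V := htors.isScalarTower
  let : Algebra κ Q := σ.toRingHom.toAlgebra
  have hσalg : ∀ z, algebraMap κ Q z = σ z := fun z => rfl
  let : Module κ V := Module.compHom V σ.toRingHom
  have : IsScalarTower κ Q V := ⟨fun z q v => by
    rw [Algebra.smul_def, mul_smul]; rfl⟩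
  have hκV : ∀ (z : κ) (v : V), σ z • v = z • v := fun z v => rfl
  have hlen : Module.length κ V = m := by
    rw [length_eq_of_residue (κ := κ) (Q := Q) (V := V), ← hV]
    · exact (Module.length_eq_of_surjective (S := S) (R := Q) (M := V)
        Ideal.Quotient.mk_surjective).symm
    · intro x
      obtain ⟨q, rfl⟩ := IsLocalRing.residue_surjective x
      refine ⟨g q, ?_⟩
      change IsLocalRing.residue Q (σ (g q)) = IsLocalRing.residue Q q
      rw [← sub_eq_zero, ← map_sub, IsLocalRing.residue_eq_zero_iff]
      have h1 : g (σ (g q) - q) = 0 := by rw [map_sub, hσ, sub_self]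
      have h2 : IsNilpotent (σ (g q) - q) := by
        refine ⟨N + 1, ?_⟩
        have := Ideal.pow_mem_pow (hker _ h1) (N + 1)
        rw [hMN] at this
        exact this
      rw [IsLocalRing.mem_maximalIdeal]
      exact h2.not_isUnit
  have hfin : Module.Finite κ V := by
    have h1 : Module.length κ V ≠ ⊤ := by rw [hlen]; exact ENat.natCast_ne_top m
    rw [Module.length_ne_top_iff, isFiniteLength_iff_isNoetherian_isArtinian] at h1
    have := h1.1
    infer_instance
  have hfr : Module.finrank κ V = m := by
    have := Module.length_eq_finrank κ V
    rw [hlen] at this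
    exact_mod_cast this.symm
  let b : Module.Basis (Fin m) κ V := Module.finBasisOfFinrankEq κ V hfr
  -- Taylor data
  let ι : MvPolynomial (Fin n) k →ₐ[k] Q :=
    (Ideal.Quotient.mkₐ k I).comp (IsScalarTower.toAlgHom k (MvPolynomial (Fin n) k) S)
  let res : MvPolynomial (Fin n) k →ₐ[k] κ :=
    (IsScalarTower.toAlgHom k S κ).comp (IsScalarTower.toAlgHom k (MvPolynomial (Fin n) k) S)
  have hres : ∀ f, res f = IsLocalRing.residue S (algebraMap _ S f) := fun f => rfl
  have hι : ∀ f, ι f = Ideal.Quotient.mk I (algebraMap _ S f) := fun f => rfl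
  have : IsScalarTower k A κ := IsScalarTower.of_algebraMap_eq fun x => by
    rw [IsScalarTower.algebraMap_apply k S κ, IsScalarTower.algebraMap_apply k A S]; rfl
  have : IsScalarTower k A Q := IsScalarTower.of_algebraMap_eq fun x => by
    rw [IsScalarTower.algebraMap_apply k S Q, IsScalarTower.algebraMap_apply k A S]; rfl
  let σk : κ →ₐ[k] Q := σ.restrictScalars k
  let y : Fin n → Q := fun i => ι (X i) - σk (res (X i))
  have hy : ∀ i, y i ^ (N + 1) = 0 := by
    intro i
    have h1 : g (y i) = 0 := by
      change g (ι (X i) - σ (res (X i))) = 0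
      rw [map_sub, hσ, hι, hgmk, hres, sub_self]
    have := Ideal.pow_mem_pow (hker _ h1) (N + 1)
    rw [hMN] at this
    exact this
  have hy0 : ∀ i : Fin n, c ≤ (i : ℕ) → y i = 0 := by
    intro i hi
    have h1 : res (X i) = algebraMap A κ (X ⟨i, hi⟩) := by
      rw [hres, IsScalarTower.algebraMap_apply A S κ, hA]; rfl
    have h2 : ι (X i) = algebraMap A Q (X ⟨i, hi⟩) := by
      rw [hι, IsScalarTower.algebraMap_apply A S Q, hA]; rfl
    change ι (X i) - σ (res (X i)) = 0
    rw [h1, h2, AlgHom.commutes, sub_self]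
  let F := Fintype.piFinset (fun _ : Fin n => Finset.range (N + 1))
  let D : Fin m → Fin r → (Fin n → ℕ) → κ := fun i j a =>
    (algebraMap k κ (∏ l, ((a l).factorial : k))⁻¹) * b.coord i ((∏ l, y l ^ a l) • e j)
  refine ⟨F, D, ?_, ?_⟩
  · intro i j a l hl ha
    have : ∏ l, y l ^ a l = 0 :=
      Finset.prod_eq_zero (Finset.mem_univ l) (by rw [hy0 l hl, zero_pow ha])
    simp [D, this]
  · intro w
    have key : ∀ i, b.coord i (∑ j, algebraMap _ S (w j) • e j) =
        ∑ j, ∑ a ∈ F, D i j a * IsLocalRing.residue S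
          (algebraMap _ S (derivOp (Finsupp.equivFunOnFinite.symm a) (w j))) := by
      intro i
      rw [map_sum]
      refine Finset.sum_congr rfl fun j _ => ?_
      rw [← hQV, ← hι, taylor ι res σk (N + 1) hy (w j), Finset.sum_smul, map_sum]
      refine Finset.sum_congr rfl fun a _ => ?_
      rw [mul_smul]
      change b.coord i (σ _ • _) = _
      rw [hκV, map_smul, smul_eq_mul, ← hres]
      simp only [D]
      change _ * _ * b.coord i ((∏ l, y l ^ a l) • e j) = _
      ring
    simp only [← key]
    exact b.ext_elem_iff.trans (by simp)

/-- a `p`-primary submodule `U ⊆ R^r` of multiplicity `m` over `p` admits a set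
of `m` Noetherian operators `δ_1,…,δ_m ∈ D_{n,c}^r` in the relative Weyl algebra, i.e.
`U = {w ∈ R^r | δ_i(w) ∈ p for all i}`. -/
theorem stmt4 (n c r m : ℕ) (k : Type*) [Field k] [CharZero k] (hc : c ≤ n) (hr : 1 ≤ r)
    (p : Ideal (MvPolynomial (Fin n) k)) [p.IsPrime]
    (hht : Order.height (⟨p, inferInstance⟩ : PrimeSpectrum (MvPolynomial (Fin n) k)) =
      (c : ℕ∞))
    (hbasis : AlgebraicIndependent k
      (fun i : {i : Fin n // c ≤ (i : ℕ)} => Ideal.Quotient.mk p (X i.1)))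
    (U : Submodule (MvPolynomial (Fin n) k) (Fin r → MvPolynomial (Fin n) k))
    (hU : IsPrimarySubmodule p U) (hmult : multOver p U = (m : WithBot ℕ∞)) :
    ∃ δ : Fin m → DiffOp n k r, (∀ i, (δ i).InRelWeyl c) ∧
      (U : Set (Fin r → MvPolynomial (Fin n) k)) =
        {w | ∀ i : Fin m, (δ i).act w ∈ p} := by
  classical
  let R := MvPolynomial (Fin n) k
  let A := MvPolynomial {i : Fin n // c ≤ (i : ℕ)} k
  let S := Localization.AtPrime p
  let : Algebra A S := ((algebraMap R S).comp (rename Subtype.val : A →ₐ[k] R).toRingHom).toAlgebra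
  have hAS : ∀ a : A, algebraMap A S a = algebraMap R S (rename Subtype.val a) := fun a => rfl
  have : IsScalarTower k A S := IsScalarTower.of_algebraMap_eq (R := k) (S := A) (A := S) fun x => by
    rw [hAS, AlgHom.commutes, ← IsScalarTower.algebraMap_apply k R S]
  have : IsScalarTower k A p.ResidueField := IsScalarTower.of_algebraMap_eq fun x => by
    rw [IsScalarTower.algebraMap_apply k S p.ResidueField, IsScalarTower.algebraMap_apply k A S]
    rfl
  have hresS : ∀ f : R, IsLocalRing.residue S (algebraMap R S f) =
    algebraMap R p.ResidueField f := fun f => rfl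
  have hresA : ∀ a : A, algebraMap A p.ResidueField a =
    algebraMap R p.ResidueField (rename Subtype.val a) := fun a => rfl
  have hfs : Algebra.FormallySmooth A p.ResidueField := by
    refine formallySmooth_of_height hc ?_ ?_ ?_ ?_
    · intro i
      rw [hresA, rename_X]
    · rw [injective_iff_map_eq_zero]
      intro a ha
      rw [hresA, Ideal.algebraMap_residueField_eq_zero, ← Ideal.Quotient.eq_zero_iff_mem] at ha
      apply (injective_iff_map_eq_zero _).mp hbasis a
      rw [← ha]
      have h : aeval (fun i : {i : Fin n // c ≤ (i : ℕ)} => Ideal.Quotient.mk p (X i.1)) =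
          (Ideal.Quotient.mkₐ k p).comp (rename Subtype.val : A →ₐ[k] R) := by
        apply MvPolynomial.algHom_ext
        intro i
        simp
      rw [h]
      rfl
    · intro z
      obtain ⟨f, g, _, rfl⟩ := IsFractionRing.div_surjective (A := R ⧸ p) z
      obtain ⟨f, rfl⟩ := Ideal.Quotient.mk_surjective f
      obtain ⟨g, rfl⟩ := Ideal.Quotient.mk_surjective g
      exact ⟨f, g, rfl⟩
    · rw [Ideal.ker_algebraMap_residueField, ← hht]
      exact PrimeSpectrum.height_eq_orderHeight ⟨p, inferInstance⟩
  let V := LocalizedModule p.primeCompl ((Fin r → R) ⧸ U)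
  have hV : Module.length S V = m := by
    have h : (Module.length S V : WithBot ℕ∞) = (m : WithBot ℕ∞) := by
      rw [Module.coe_length]; exact hmult
    exact_mod_cast h
  let φ : (Fin r → R) →ₗ[R] V := (LocalizedModule.mkLinearMap p.primeCompl _).comp U.mkQ
  let e : Fin r → V := fun j => φ (Pi.single j 1)
  have hφ : ∀ w, φ w = ∑ j, algebraMap R S (w j) • e j := by
    intro w
    conv_lhs => rw [pi_eq_sum_univ' w]
    rw [map_sum]
    refine Finset.sum_congr rfl fun j _ => ?_
    rw [map_smul, algebraMap_smul]
  have hφU : ∀ w, φ w = 0 ↔ w ∈ U := by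
    intro w
    refine ⟨fun h => ?_, fun h => ?_⟩
    · rw [← Submodule.Quotient.mk_eq_zero]
      by_contra hne
      have h' : LocalizedModule.mk (U.mkQ w) (1 : p.primeCompl) = 0 := h
      rw [← LocalizedModule.zero_mk (1 : p.primeCompl), LocalizedModule.mk_eq] at h'
      obtain ⟨s, hs⟩ := h'
      simp only [one_smul, smul_zero] at hs
      obtain ⟨q, hq, hle⟩ := exists_le_isAssociatedPrime_of_isNoetherianRing R _ hne
      have hq' : q ∈ associatedPrimes R ((Fin r → R) ⧸ U) := hq
      rw [hU] at hq'
      rw [Set.mem_singleton_iff] at hq'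
      subst hq'
      exact s.2 (hle (by simpa [Submodule.mem_colon_singleton, Submonoid.smul_def] using hs))
    · have : U.mkQ w = 0 := (Submodule.Quotient.mk_eq_zero U).mpr h
      simp only [φ, LinearMap.comp_apply, this, map_zero]
  obtain ⟨F, D, hD, hw⟩ := core (c := c) (r := r) (m := m) (k := k) (S := S) (V := V)
    (fun i => by rw [hAS, rename_X]) hV e
  obtain ⟨d, hd⟩ := IsLocalization.exist_integer_multiples_of_finset (nonZeroDivisors (R ⧸ p))
    ((Finset.univ ×ˢ Finset.univ ×ˢ F).image
      (fun t : Fin m × Fin r × (Fin n → ℕ) => D t.1 t.2.1 t.2.2))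
  have hlift : ∀ i j a, a ∈ F → ∃ f : R, algebraMap R p.ResidueField f =
      algebraMap (R ⧸ p) p.ResidueField d * D i j a := by
    intro i j a ha
    obtain ⟨f, hf⟩ := hd (D i j a) (Finset.mem_image.mpr ⟨(i, j, a), by simp [ha], rfl⟩)
    obtain ⟨f, rfl⟩ := Ideal.Quotient.mk_surjective f
    refine ⟨f, ?_⟩
    rw [← Algebra.smul_def]
    exact hf
  choose! E hE using hlift
  let E' : Fin m → Fin r → (Fin n → ℕ) → R := fun i j a =>
    if ∃ l : Fin n, c ≤ (l : ℕ) ∧ a l ≠ 0 then 0 else E i j a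
  have hE' : ∀ i j a, a ∈ F → algebraMap R p.ResidueField (E' i j a) =
      algebraMap (R ⧸ p) p.ResidueField d * D i j a := by
    intro i j a ha
    by_cases h : ∃ l : Fin n, c ≤ (l : ℕ) ∧ a l ≠ 0
    · obtain ⟨l, hl, hal⟩ := id h
      simp only [E', if_pos h, hD i j a l hl hal, map_zero, mul_zero]
    · simp only [E', if_neg h]
      exact hE i j a ha
  let δ : Fin m → DiffOp n k r := fun i j =>
    ∑ a ∈ F, Finsupp.single (Finsupp.equivFunOnFinite.symm a) (E' i j a)
  have hact : ∀ i w, (δ i).act w =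
      ∑ j, ∑ a ∈ F, E' i j a * derivOp (Finsupp.equivFunOnFinite.symm a) (w j) := by
    intro i w
    unfold DiffOp.act
    rw [LinearMap.sum_apply]
    refine Finset.sum_congr rfl fun j _ => ?_
    simp only [δ]
    rw [← Finsupp.sum_finsetSum_index (by simp) (by intros; rw [add_smul]), LinearMap.sum_apply]
    refine Finset.sum_congr rfl fun a _ => ?_
    rw [Finsupp.sum_single_index (by simp)]
    simp
  have hd0 : algebraMap (R ⧸ p) p.ResidueField d ≠ 0 :=
    IsFractionRing.to_map_ne_zero_of_mem_nonZeroDivisors d.2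
  refine ⟨δ, ?_, ?_⟩
  · intro i j α hα l hl
    by_contra hne
    rw [Finsupp.mem_support_iff] at hα
    apply hα
    simp only [δ]
    rw [Finsupp.finsetSum_apply]
    refine Finset.sum_eq_zero fun a _ => ?_
    rw [Finsupp.single_apply]
    split_ifs with h
    · simp only [E']
      rw [if_pos]
      refine ⟨l, hl, ?_⟩
      rw [← h] at hne
      exact hne
    · rfl
  · ext w
    rw [SetLike.mem_coe, Set.mem_ofPred_eq, ← hφU, hφ, hw w]
    refine forall_congr' fun i => ?_
    rw [← Ideal.algebraMap_residueField_eq_zero (I := p), hact, map_sum]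
    have : ∑ j, algebraMap R p.ResidueField
        (∑ a ∈ F, E' i j a * derivOp (Finsupp.equivFunOnFinite.symm a) (w j)) =
        algebraMap (R ⧸ p) p.ResidueField d * ∑ j, ∑ a ∈ F, D i j a * IsLocalRing.residue S
          (algebraMap _ S (derivOp (Finsupp.equivFunOnFinite.symm a) (w j))) := by
      rw [Finset.mul_sum]
      refine Finset.sum_congr rfl fun j _ => ?_
      rw [map_sum, Finset.mul_sum]
      refine Finset.sum_congr rfl fun a ha => ?_
      rw [map_mul, hE' i j a ha, hresS, mul_assoc]
    rw [this, mul_eq_zero, or_iff_right hd0]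
end

section
/- Let k be a field of characteristic zero, R = k[x_1,…,x_n], p a prime ideal of R, and δ_1,…,δ_m ∈ D_n^r differential operators. Let 𝒢 be the R-bimodule generated by δ_1,…,δ_m. Then the set Sol := {w ∈ R^r | δ(w) ∈ p for all δ ∈ 𝒢} is an R-submodule of R^r, and if Sol ≠ R^r then Sol is a p-primary R-submodule of R^r. -/
set_option maxHeartbeats 1000000
set_option synthInstance.maxHeartbeats 400000

open MvPolynomial

section DiffOps

variable {n : ℕ} {k : Type*} [CommSemiring k]

/-- The `R`-bimodule generated by a set `s` of `k`-linear maps `R^r → R`: the smallest set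
containing `s` that is closed under addition, under `δ ↦ (w ↦ f·δ(w))`, and under
`δ ↦ (w ↦ δ(f·w))` for every `f ∈ R`. -/
def bimodGen {r : ℕ}
    (s : Set ((Fin r → MvPolynomial (Fin n) k) →ₗ[k] MvPolynomial (Fin n) k)) :
    Set ((Fin r → MvPolynomial (Fin n) k) →ₗ[k] MvPolynomial (Fin n) k) :=
  ⋂₀ {T | s ⊆ T ∧ (∀ a ∈ T, ∀ b ∈ T, a + b ∈ T) ∧
      (∀ f : MvPolynomial (Fin n) k, ∀ a ∈ T, f • a ∈ T) ∧
      (∀ f : MvPolynomial (Fin n) k, ∀ a ∈ T,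
        a.comp (f • (LinearMap.id : (Fin r → MvPolynomial (Fin n) k) →ₗ[k]
          (Fin r → MvPolynomial (Fin n) k))) ∈ T)}

end DiffOps

section Helpers

variable {n r : ℕ} {k : Type*} [Field k]

/-- Right multiplication by `f`. -/
noncomputable def rightMul (f : MvPolynomial (Fin n) k) :
    Module.End (MvPolynomial (Fin n) k)
      ((Fin r → MvPolynomial (Fin n) k) →ₗ[k] MvPolynomial (Fin n) k) where
  toFun g := g.comp (f • (LinearMap.id : (Fin r → MvPolynomial (Fin n) k) →ₗ[k]
          (Fin r → MvPolynomial (Fin n) k)))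
  map_add' a b := by ext1; rfl
  map_smul' c a := by ext1; rfl

/-- Commutator with `f`. -/
noncomputable def adOp (f : MvPolynomial (Fin n) k) :
    Module.End (MvPolynomial (Fin n) k)
      ((Fin r → MvPolynomial (Fin n) k) →ₗ[k] MvPolynomial (Fin n) k) :=
  rightMul f - f • LinearMap.id

lemma adOp_apply (f : MvPolynomial (Fin n) k)
    (g : (Fin r → MvPolynomial (Fin n) k) →ₗ[k] MvPolynomial (Fin n) k)
    (w : Fin r → MvPolynomial (Fin n) k) : adOp f g w = g (f • w) - f * g w := rfl

lemma rightMul_apply (f : MvPolynomial (Fin n) k)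
    (g : (Fin r → MvPolynomial (Fin n) k) →ₗ[k] MvPolynomial (Fin n) k)
    (w : Fin r → MvPolynomial (Fin n) k) : rightMul f g w = g (f • w) := rfl

lemma adOp_commute (f h : MvPolynomial (Fin n) k) :
    Commute (adOp (r := r) f) (rightMul h) := by
  refine LinearMap.ext fun g => LinearMap.ext fun w => ?_
  simp only [Module.End.mul_apply, adOp_apply, rightMul_apply, smul_smul, mul_comm]

lemma adOp_pderiv (f : MvPolynomial (Fin n) k) (i : Fin n)
    (T : (Fin r → MvPolynomial (Fin n) k) →ₗ[k] MvPolynomial (Fin n) k) :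
    adOp f ((pderiv i).toLinearMap.comp T) =
      pderiv i f • T + (pderiv i).toLinearMap.comp (adOp f T) := by
  refine LinearMap.ext fun w => ?_
  simp [adOp_apply, Derivation.leibniz]
  ring

lemma adOp_pow_pderiv (f : MvPolynomial (Fin n) k) (i : Fin n) (d : ℕ) :
    ∀ T : (Fin r → MvPolynomial (Fin n) k) →ₗ[k] MvPolynomial (Fin n) k,
    (adOp f ^ d) T = 0 → (adOp f ^ (d + 1)) ((pderiv i).toLinearMap.comp T) = 0 := by
  induction d with
  | zero =>
    intro T hT
    have : T = 0 := by simpa using hT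
    subst this
    simp
  | succ d ih =>
    intro T hT
    rw [pow_succ, Module.End.mul_apply, adOp_pderiv, map_add, map_smul, hT, smul_zero, zero_add]
    apply ih
    rwa [pow_succ, Module.End.mul_apply] at hT

/-- Operators preserving ad-nilpotency. -/
def nilStab (r : ℕ) (f : MvPolynomial (Fin n) k) :
    Submonoid (Module.End k (MvPolynomial (Fin n) k)) where
  carrier := {E | ∀ T : (Fin r → MvPolynomial (Fin n) k) →ₗ[k] MvPolynomial (Fin n) k,
    (∃ d, (adOp f ^ d) T = 0) → ∃ d, (adOp f ^ d) (E.comp T) = 0}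
  one_mem' := fun _ h => h
  mul_mem' := fun ha hb T h => ha _ (hb T h)

lemma nil_derivOp (f : MvPolynomial (Fin n) k) (α : Fin n →₀ ℕ) (j : Fin r) :
    ∃ d, (adOp f ^ d) ((derivOp α).comp
      (LinearMap.proj j : (Fin r → MvPolynomial (Fin n) k) →ₗ[k] MvPolynomial (Fin n) k)) = 0 := by
  have h : derivOp α ∈ nilStab r f := by
    apply Submonoid.list_prod_mem
    intro x hx
    rw [List.mem_ofFn] at hx
    obtain ⟨i, rfl⟩ := hx
    apply Submonoid.pow_mem
    rintro T ⟨d, hd⟩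
    exact ⟨d + 1, adOp_pow_pderiv f i d T hd⟩
  apply h
  refine ⟨1, LinearMap.ext fun w => ?_⟩
  rw [pow_one, adOp_apply]
  simp

lemma nil_act (f : MvPolynomial (Fin n) k) (δ : DiffOp n k r) :
    ∃ d, (adOp f ^ d) δ.act = 0 := by
  have key : ∀ g : (Fin r → MvPolynomial (Fin n) k) →ₗ[k] MvPolynomial (Fin n) k,
      g ∈ Module.End.maxGenEigenspace (adOp f) 0 ↔ ∃ d, (adOp f ^ d) g = 0 := by
    intro g
    rw [Module.End.mem_maxGenEigenspace, zero_smul]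
    have h0 : adOp (r := r) f - 0 = adOp f := by
      refine LinearMap.ext fun g => LinearMap.ext fun w => ?_
      exact sub_zero (adOp f g w)
    rw [h0]
  rw [← key]
  unfold DiffOp.act Finsupp.sum
  refine Submodule.sum_mem _ fun j _ => Submodule.sum_mem _ fun α _ => ?_
  exact Submodule.smul_mem _ _ ((key _).2 (nil_derivOp f α j))

lemma bimodGen_nil {m : ℕ} (f : MvPolynomial (Fin n) k) (δ : Fin m → DiffOp n k r) :
    ∃ d, ∀ g ∈ bimodGen (Set.range fun i => (δ i).act), (adOp f ^ d) g = 0 := by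
  choose d hd using fun i => nil_act f (δ i)
  refine ⟨∑ i, d i, fun g hg => ?_⟩
  refine hg {g | (adOp f ^ (∑ i, d i)) g = 0} ⟨?_, ?_, ?_, ?_⟩
  · rintro _ ⟨i, rfl⟩
    have : d i ≤ ∑ i, d i := Finset.single_le_sum (fun _ _ => Nat.zero_le _) (Finset.mem_univ i)
    exact Module.End.pow_map_zero_of_le this (hd i)
  · intro a ha b hb
    simp only [Set.mem_ofPred_eq] at *
    rw [map_add, ha, hb, add_zero]
  · intro c a ha
    simp only [Set.mem_ofPred_eq] at *
    rw [map_smul, ha, smul_zero]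
  · intro c a ha
    simp only [Set.mem_ofPred_eq] at *
    have h := ((adOp_commute (r := r) f c).pow_left (∑ i, d i)).eq
    have h2 := LinearMap.congr_fun h a
    rw [Module.End.mul_apply, Module.End.mul_apply, ha, map_zero] at h2
    exact h2

variable {s : Set ((Fin r → MvPolynomial (Fin n) k) →ₗ[k] MvPolynomial (Fin n) k)}

lemma bimodGen_add {a b} (ha : a ∈ bimodGen s) (hb : b ∈ bimodGen s) : a + b ∈ bimodGen s :=
  fun T hT => hT.2.1 a (ha T hT) b (hb T hT)

lemma bimodGen_smul (f : MvPolynomial (Fin n) k) {a} (ha : a ∈ bimodGen s) :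
    f • a ∈ bimodGen s :=
  fun T hT => hT.2.2.1 f a (ha T hT)

lemma bimodGen_right (f : MvPolynomial (Fin n) k) {a} (ha : a ∈ bimodGen s) :
    rightMul f a ∈ bimodGen s :=
  fun T hT => hT.2.2.2 f a (ha T hT)

lemma bimodGen_ad (f : MvPolynomial (Fin n) k) {a} (ha : a ∈ bimodGen s) :
    adOp f a ∈ bimodGen s := by
  have : adOp f a = rightMul f a + (-f) • a := by
    refine LinearMap.ext fun w => ?_
    rw [adOp_apply, LinearMap.add_apply, LinearMap.smul_apply, rightMul_apply, smul_eq_mul]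
    ring
  rw [this]
  exact bimodGen_add (bimodGen_right f ha) (bimodGen_smul _ ha)

lemma pow_smul_mem (p : Ideal (MvPolynomial (Fin n) k)) {f : MvPolynomial (Fin n) k} (hf : f ∈ p)
    (w : Fin r → MvPolynomial (Fin n) k) (d : ℕ) :
    ∀ g : (Fin r → MvPolynomial (Fin n) k) →ₗ[k] MvPolynomial (Fin n) k,
      (adOp f ^ d) g = 0 → g (f ^ d • w) ∈ p := by
  induction d with
  | zero =>
    intro g hg
    have : g = 0 := by simpa using hg
    simp [this]
  | succ d ih =>
    intro g hg
    rw [pow_succ, Module.End.mul_apply] at hg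
    have h1 := ih _ hg
    rw [adOp_apply, smul_smul, ← pow_succ'] at h1
    exact (Submodule.sub_mem_iff_left p (p.mul_mem_right _ hf)).1 h1

lemma cancel_mem (p : Ideal (MvPolynomial (Fin n) k)) [p.IsPrime]
    {f : MvPolynomial (Fin n) k} (hf : f ∉ p)
    (w : Fin r → MvPolynomial (Fin n) k) (hw : ∀ g ∈ bimodGen s, g (f • w) ∈ p) (d : ℕ) :
    ∀ g ∈ bimodGen s, (adOp f ^ d) g = 0 → g w ∈ p := by
  induction d with
  | zero =>
    intro g _ hg
    have : g = 0 := by simpa using hg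
    simp [this]
  | succ d ih =>
    intro g hgs hg
    rw [pow_succ, Module.End.mul_apply] at hg
    have h1 := ih _ (bimodGen_ad f hgs) hg
    rw [adOp_apply] at h1
    have h2 := (Submodule.sub_mem_iff_right p (hw g hgs)).1 h1
    exact (Ideal.IsPrime.mem_or_mem ‹_› h2).resolve_left hf

end Helpers

/-- if `𝒢` is the `R`-bimodule generated by differential operators
`δ_1,…,δ_m ∈ D_n^r` and `p` is a prime of `R = k[x_1,…,x_n]`, then
`Sol = {w ∈ R^r | δ(w) ∈ p for all δ ∈ 𝒢}` is an `R`-submodule of `R^r`, and if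
`Sol ≠ R^r` then it is a `p`-primary submodule. -/
theorem stmt5 (n r m : ℕ) (k : Type*) [Field k] [CharZero k]
    (p : Ideal (MvPolynomial (Fin n) k)) [p.IsPrime]
    (δ : Fin m → DiffOp n k r) :
    ∃ U : Submodule (MvPolynomial (Fin n) k) (Fin r → MvPolynomial (Fin n) k),
      (U : Set (Fin r → MvPolynomial (Fin n) k)) =
        {w | ∀ g ∈ bimodGen (Set.range fun i => (δ i).act), g w ∈ p} ∧
      (({w | ∀ g ∈ bimodGen (Set.range fun i => (δ i).act), g w ∈ p} ≠
          (Set.univ : Set (Fin r → MvPolynomial (Fin n) k))) →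
        associatedPrimes (MvPolynomial (Fin n) k)
          ((Fin r → MvPolynomial (Fin n) k) ⧸ U) = {p}) := by
  let U : Submodule (MvPolynomial (Fin n) k) (Fin r → MvPolynomial (Fin n) k) :=
    { carrier := {w | ∀ g ∈ bimodGen (Set.range fun i => (δ i).act), g w ∈ p}
      add_mem' := fun {a b} ha hb g hg => by
        rw [map_add]; exact p.add_mem (ha g hg) (hb g hg)
      zero_mem' := fun g _ => by rw [map_zero]; exact p.zero_mem
      smul_mem' := fun f w hw g hg => hw _ (bimodGen_right f hg) }
  have hU : ∀ w, w ∈ U ↔ ∀ g ∈ bimodGen (Set.range fun i => (δ i).act), g w ∈ p :=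
    fun w => Iff.rfl
  refine ⟨U, rfl, fun hne => ?_⟩
  have hsub : ∀ q ∈ associatedPrimes (MvPolynomial (Fin n) k)
      ((Fin r → MvPolynomial (Fin n) k) ⧸ U), q = p := by
    rintro q hq
    obtain ⟨hqp, x, hx⟩ := isAssociatedPrime_iff.1 (AssociatedPrimes.mem_iff.1 hq)
    obtain ⟨w, rfl⟩ := U.mkQ_surjective x
    have hmem : ∀ f, f ∈ q ↔ f • w ∈ U := by
      intro f
      rw [hx, Submodule.mem_colon_singleton, Submodule.mem_bot, ← map_smul, Submodule.mkQ_apply,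
        Submodule.Quotient.mk_eq_zero]
    have hwU : w ∉ U := fun h => hqp.ne_top ((Ideal.eq_top_iff_one _).2 ((hmem 1).2 (by simpa using h)))
    ext f
    constructor
    · intro hf
      by_contra hfp
      obtain ⟨d, hd⟩ := bimodGen_nil f δ
      exact hwU fun g hg => cancel_mem p hfp w ((hU _).1 ((hmem f).1 hf)) d g hg (hd g hg)
    · intro hf
      obtain ⟨d, hd⟩ := bimodGen_nil f δ
      exact hqp.mem_of_pow_mem d ((hmem _).2 fun g hg => pow_smul_mem p hf w d g (hd g hg))
  have hnt : Nontrivial ((Fin r → MvPolynomial (Fin n) k) ⧸ U) := by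
    rw [Submodule.Quotient.nontrivial_iff]
    rintro h
    apply hne
    have : (U : Set (Fin r → MvPolynomial (Fin n) k)) = Set.univ := by rw [h]; rfl
    exact this
  obtain ⟨q, hq⟩ := associatedPrimes.nonempty (MvPolynomial (Fin n) k)
    ((Fin r → MvPolynomial (Fin n) k) ⧸ U)
  refine Set.eq_singleton_iff_unique_mem.2 ⟨?_, hsub⟩
  rw [← hsub q hq]
  exact hq
end

section
/- Let k be a field of characteristic zero, R = k[x_1,…,x_n], p a prime ideal of R, and δ_1,…,δ_m ∈ D_n^r differential operators. Let 𝒢 be the R-bimodule generated by δ_1,…,δ_m. Then {w ∈ R^r | δ(w) ∈ p for all δ ∈ 𝒢} ⊆ {w ∈ R^r | δ_i(w) ∈ p for all 1 ≤ i ≤ m}, and equality holds if and only if the right-hand side is an R-submodule of R^r. -/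
set_option maxHeartbeats 1000000
set_option synthInstance.maxHeartbeats 400000

open MvPolynomial

/-- with `𝒢` the `R`-bimodule generated by `δ_1,…,δ_m ∈ D_n^r` and `p` a prime
of `R`, the solution set of `𝒢` is contained in that of the `δ_i`, and equality holds if and
only if the latter is an `R`-submodule of `R^r`. -/
theorem stmt6 (n r m : ℕ) (k : Type*) [Field k] [CharZero k]
    (p : Ideal (MvPolynomial (Fin n) k)) [p.IsPrime]
    (δ : Fin m → DiffOp n k r) :
    {w | ∀ g ∈ bimodGen (Set.range fun i => (δ i).act), g w ∈ p} ⊆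
      {w : Fin r → MvPolynomial (Fin n) k | ∀ i : Fin m, (δ i).act w ∈ p} ∧
    ({w | ∀ g ∈ bimodGen (Set.range fun i => (δ i).act), g w ∈ p} =
        {w : Fin r → MvPolynomial (Fin n) k | ∀ i : Fin m, (δ i).act w ∈ p} ↔
      ∃ U : Submodule (MvPolynomial (Fin n) k) (Fin r → MvPolynomial (Fin n) k),
        (U : Set (Fin r → MvPolynomial (Fin n) k)) =
          {w : Fin r → MvPolynomial (Fin n) k | ∀ i : Fin m, (δ i).act w ∈ p}) := by
  have hsub : ∀ i, (δ i).act ∈ bimodGen (Set.range fun i => (δ i).act) :=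
    fun i T hT => hT.1 ⟨i, rfl⟩
  have h1 : {w | ∀ g ∈ bimodGen (Set.range fun i => (δ i).act), g w ∈ p} ⊆
      {w : Fin r → MvPolynomial (Fin n) k | ∀ i : Fin m, (δ i).act w ∈ p} :=
    fun w hw i => hw _ (hsub i)
  refine ⟨h1, ?_, ?_⟩
  · intro h
    refine ⟨{ carrier := {w | ∀ g ∈ bimodGen (Set.range fun i => (δ i).act), g w ∈ p}
              add_mem' := ?_, zero_mem' := ?_, smul_mem' := ?_ }, h⟩
    · intro a b ha hb g hg
      rw [map_add]
      exact p.add_mem (ha g hg) (hb g hg)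
    · intro g _
      rw [map_zero]
      exact p.zero_mem
    · intro f w hw g hg
      exact hw (g.comp (f • LinearMap.id))
        (fun T hT => hT.2.2.2 f g (hg T hT))
  · rintro ⟨U, hU⟩
    refine Set.Subset.antisymm h1 ?_
    rw [← hU]
    intro w hw g hg
    refine hg {g | ∀ w ∈ U, g w ∈ p} ⟨?_, ?_, ?_, ?_⟩ w hw
    · rintro _ ⟨i, rfl⟩ v hv
      have hv' : v ∈ (U : Set (Fin r → MvPolynomial (Fin n) k)) := hv
      rw [hU] at hv'
      exact hv' i
    · intro a ha b hb v hv
      exact p.add_mem (ha v hv) (hb v hv)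
    · intro f a ha v hv
      exact p.mul_mem_left f (ha v hv)
    · intro f a ha v hv
      exact ha (f • v) (U.smul_mem f hv)
end

section
/- Let k be a field of characteristic zero, R = k[x_1,…,x_n], and let U ⊆ R^r be a proper R-submodule with associated primes Ass_R(R^r/U) = {p_1,…,p_k}. Then there exist, for each 1 ≤ i ≤ k, a subset S_i ⊆ {x_1,…,x_n} that is a basis modulo p_i, and a finite set 𝔄_i of differential operators in D_n(S_i)^r, with Σ_{i=1}^k |𝔄_i| equal to the arithmetic multiplicity amult(U), such that for every p ∈ Ass_R(R^r/U): {w ∈ R^r | s·w ∈ U for some s ∈ R∖p} = ⋂_{i : p_i ⊆ p} {w ∈ R^r | δ(w) ∈ p_i for all δ ∈ 𝔄_i}. In particular, U = {w ∈ R^r | δ(w) ∈ p_i for all δ ∈ 𝔄_i and all 1 ≤ i ≤ k}; i.e., U admits a differential primary decomposition of minimal size amult(U). -/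
set_option maxHeartbeats 1000000
set_option synthInstance.maxHeartbeats 400000

open MvPolynomial

section DiffOps

variable {n : ℕ} {k : Type*} [CommSemiring k]

/-- `δ` lies in `D_n(S)^r`, i.e. involves only `∂_{x_i}` for `x_i ∉ S`:
`c_{j,α} = 0` whenever `α_l ≠ 0` for some `l ∈ S`. -/
def DiffOp.InRelWeylSet {r : ℕ} (S : Finset (Fin n)) (δ : DiffOp n k r) : Prop :=
  ∀ j : Fin r, ∀ α ∈ (δ j).support, ∀ l : Fin n, l ∈ S → α l = 0

end DiffOps

section Mult

variable {R : Type*} [CommRing R]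

/-- The length over `R_p` of `Γ_p(M_p)`, the submodule of the localization `M_p` of
elements annihilated by some power of `p`; length is expressed as the Krull dimension of
the lattice of `R_p`-submodules. For `M = R^r/U` this is the local contribution of `p` to
the arithmetic multiplicity `amult(U)`. -/
noncomputable def satLength (p : Ideal R) (hp : p.IsPrime)
    (M : Type*) [AddCommGroup M] [Module R M] : WithBot ℕ∞ :=
  haveI := hp
  Order.krullDim (Submodule (Localization.AtPrime p)
    ↥(⨆ j : ℕ, Submodule.torsionBySet (Localization.AtPrime p)
        (LocalizedModule p.primeCompl M)
        (((p.map (algebraMap R (Localization.AtPrime p))) ^ j :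
          Ideal (Localization.AtPrime p)) : Set (Localization.AtPrime p))))

end Mult


lemma dpd_height_one {D : Type*} [CommRing D] [IsDomain D] (Q : Ideal (Polynomial D)) [Q.IsPrime]
    (h0 : Q ≠ ⊥) (hc : Q.comap Polynomial.C = ⊥) : Q.height = 1 := by
  let K := FractionRing D
  let : Algebra (Polynomial D) (Polynomial K) := Polynomial.algebra D K
  have : IsLocalization (Submonoid.map Polynomial.C (nonZeroDivisors D)) (Polynomial K) :=
    Polynomial.isLocalization _ K
  have disj : Disjoint ((Submonoid.map Polynomial.C (nonZeroDivisors D) : Submonoid (Polynomial D)) : Set (Polynomial D)) (Q : Set (Polynomial D)) := by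
    refine Set.disjoint_left.mpr ?_
    rintro a ⟨b, hb, rfl⟩ ha
    have : b ∈ Q.comap Polynomial.C := ha
    rw [hc] at this
    exact nonZeroDivisors.ne_zero hb this
  have hh := IsLocalization.height_map_of_disjoint (S := Polynomial K) (Submonoid.map Polynomial.C (nonZeroDivisors D)) Q disj
  rw [← hh]
  have hp : (Q.map (algebraMap (Polynomial D) (Polynomial K))).IsPrime :=
    IsLocalization.isPrime_of_isPrime_disjoint (Submonoid.map Polynomial.C (nonZeroDivisors D)) _ Q inferInstance disj
  have hne : Q.map (algebraMap (Polynomial D) (Polynomial K)) ≠ ⊥ := by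
    intro h
    rw [Ideal.map_eq_bot_iff_le_ker] at h
    apply h0
    rw [eq_bot_iff]
    refine h.trans ?_
    rw [← RingHom.injective_iff_ker_eq_bot (algebraMap (Polynomial D) (Polynomial K)) |>.mp]
    exact Polynomial.map_injective _ (IsFractionRing.injective D K)
  have : (Q.map (algebraMap (Polynomial D) (Polynomial K))).IsMaximal :=
    hp.isMaximal hne
  exact IsPrincipalIdealRing.height_eq_one_of_isMaximal _ (Polynomial.not_isField K)

lemma dpd_ht_quot {B C : Type*} [CommRing B] [CommRing C] (ψ : B →+* C)
    (hψ : Function.Surjective ψ) (I : Ideal B) (hI : RingHom.ker ψ = I) (P : Ideal B) :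
    (P.map (Ideal.Quotient.mk I)).height = (P.map ψ).height := by
  subst hI
  have h1 := (RingHom.quotientKerEquivOfSurjective hψ).height_map
    (P.map (Ideal.Quotient.mk (RingHom.ker ψ)))
  rw [← h1, ← Ideal.map_coe, Ideal.map_map]
  congr 2

lemma dpd_step {k A : Type*} [Field k] [CommRing A] [IsDomain A] [IsNoetherianRing A] [Algebra k A]
    (P : Ideal (Polynomial A)) [P.IsPrime] :
    P.height + Cardinal.toENat (Algebra.trdeg k (Polynomial A ⧸ P)) =
      (P.comap Polynomial.C).height + Cardinal.toENat (Algebra.trdeg k (A ⧸ P.comap Polynomial.C)) + 1 := by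
  set q : Ideal A := P.comap Polynomial.C with hq
  have : q.IsPrime := Ideal.comap_isPrime _ _
  have : P.LiesOver q := ⟨rfl⟩
  have hadd := trdeg_add_eq k (A ⧸ q) (A := Polynomial A ⧸ P)
  have hh := Ideal.height_eq_height_add_of_liesOver_of_hasGoingDown q P
  let x : Polynomial A ⧸ P := Ideal.Quotient.mk P Polynomial.X
  let φ : Polynomial (A ⧸ q) →ₐ[A ⧸ q] (Polynomial A ⧸ P) := Polynomial.aeval x
  have hφ : ∀ f : Polynomial A, φ (f.map (Ideal.Quotient.mk q)) = Ideal.Quotient.mk P f := by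
    intro f
    induction f using Polynomial.induction_on' with
    | add f g hf hg => simp [hf, hg]
    | monomial n a =>
      simp only [Polynomial.map_monomial, φ, Polynomial.aeval_monomial, x]
      rw [Ideal.Quotient.algebraMap_mk_of_liesOver, ← map_pow, ← map_mul]
      simp [Polynomial.C_mul_X_pow_eq_monomial]
  have hsurj : Function.Surjective φ := by
    intro y
    obtain ⟨f, rfl⟩ := Ideal.Quotient.mk_surjective y
    exact ⟨_, hφ f⟩
  let Q := RingHom.ker φ
  have : Q.IsPrime := RingHom.ker_isPrime _
  have hQht : (P.map (Ideal.Quotient.mk <| q.map (algebraMap A (Polynomial A)))).height = Q.height := by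
    rw [dpd_ht_quot (Polynomial.mapRingHom (Ideal.Quotient.mk q))
      (Polynomial.map_surjective _ Ideal.Quotient.mk_surjective) _
      (by rw [Polynomial.ker_mapRingHom, Ideal.mk_ker]; rfl) P]
    have h2 : P = Q.comap (Polynomial.mapRingHom (Ideal.Quotient.mk q)) := by
      ext f
      simp only [Q, Ideal.mem_comap, RingHom.mem_ker, Polynomial.coe_mapRingHom, hφ, Ideal.Quotient.eq_zero_iff_mem]
    conv_lhs => rw [h2]
    rw [Ideal.map_comap_of_surjective]
    exact Polynomial.map_surjective _ Ideal.Quotient.mk_surjective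
  rw [hh, hQht, ← hadd]
  have key : Q.height + Cardinal.toENat (Algebra.trdeg (A ⧸ q) (Polynomial A ⧸ P)) = 1 := by
    by_cases hQ : Q = ⊥
    · have hinj : Function.Injective φ := (RingHom.injective_iff_ker_eq_bot _).mpr hQ
      rw [← (AlgEquiv.ofBijective φ ⟨hinj, hsurj⟩).trdeg_eq, Polynomial.trdeg_of_isDomain, hQ]
      simp
    · have : Algebra.IsAlgebraic (A ⧸ q) (Polynomial A ⧸ P) := by
        obtain ⟨f, hf, hf0⟩ := Submodule.exists_mem_ne_zero_of_ne_bot hQ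
        have hx : IsAlgebraic (A ⧸ q) x := ⟨f, hf0, hf⟩
        have htop : Algebra.adjoin (A ⧸ q) {x} = ⊤ := by
          rw [Algebra.adjoin_singleton_eq_range_aeval]
          exact (AlgHom.range_eq_top _).mpr hsurj
        constructor
        intro y
        have hy : y ∈ Algebra.adjoin (A ⧸ q) {x} := by rw [htop]; trivial
        exact (Algebra.adjoin_le (S := Subalgebra.algebraicClosure (A ⧸ q) (Polynomial A ⧸ P)) (Set.singleton_subset_iff.mpr hx)) hy
      rw [trdeg_eq_zero, dpd_height_one Q hQ]
      · simp
      · rw [eq_bot_iff]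
        intro a ha
        have : φ (Polynomial.C a) = 0 := ha
        simp only [φ, Polynomial.aeval_C] at this
        exact (FaithfulSMul.algebraMap_injective (A ⧸ q) (Polynomial A ⧸ P)) (by simpa using this)
  rw [map_add, add_assoc, add_assoc]
  congr 1
  rw [add_left_comm, key]

lemma dpd_transfer {k A B : Type*} [Field k] [CommRing A] [CommRing B] [Algebra k A] [Algebra k B]
    (e : A ≃ₐ[k] B) (P : Ideal A) [P.IsPrime] :
    ∃ P' : Ideal B, P'.IsPrime ∧ P'.height = P.height ∧
      Cardinal.toENat (Algebra.trdeg k (B ⧸ P')) = Cardinal.toENat (Algebra.trdeg k (A ⧸ P)) := by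
  let P' : Ideal B := P.map (e : A ≃+* B)
  refine ⟨P', Ideal.map_isPrime_of_equiv _, (e : A ≃+* B).height_map P, ?_⟩
  have h2 := (Ideal.quotientEquivAlg P P' e rfl).lift_trdeg_eq
  rw [← Cardinal.toENat_lift, ← h2, Cardinal.toENat_lift]

lemma dpd_ht_trdeg (k : Type*) [Field k] (n : ℕ) (P : Ideal (MvPolynomial (Fin n) k)) [P.IsPrime] :
    P.height + Cardinal.toENat (Algebra.trdeg k (MvPolynomial (Fin n) k ⧸ P)) = n := by
  induction n with
  | zero =>
    have hf : IsField (MvPolynomial (Fin 0) k) :=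
      (MvPolynomial.isEmptyAlgEquiv k (Fin 0)).toMulEquiv.isField (Field.toIsField k)
    have hP : P = ⊥ := by
      let := hf.toField
      exact (Ideal.eq_bot_or_top P).resolve_right Ideal.IsPrime.ne_top'
    subst hP
    have : Algebra.IsAlgebraic k (MvPolynomial (Fin 0) k ⧸ (⊥ : Ideal (MvPolynomial (Fin 0) k))) := by
      constructor
      intro y
      obtain ⟨f, rfl⟩ := Ideal.Quotient.mk_surjective y
      rw [MvPolynomial.eq_C_of_isEmpty f]
      exact isAlgebraic_algebraMap (A := MvPolynomial (Fin 0) k ⧸ (⊥ : Ideal (MvPolynomial (Fin 0) k))) (f.coeff 0)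
    rw [trdeg_eq_zero]
    simp
  | succ n ih =>
    obtain ⟨P', hP', h1, h2⟩ := dpd_transfer (MvPolynomial.finSuccEquiv k n) P
    rw [← h1, ← h2, dpd_step P', ih (P'.comap Polynomial.C)]
    simp

lemma dpd_exists_S (k : Type*) [Field k] (n : ℕ) (P : Ideal (MvPolynomial (Fin n) k)) [P.IsPrime] :
    ∃ S : Finset (Fin n), IsTranscendenceBasis k
        (fun j : {l : Fin n // l ∈ S} => Ideal.Quotient.mk P (MvPolynomial.X j.1)) ∧
      P.height + (S.card : ℕ∞) = n := by
  classical
  let f : Fin n → MvPolynomial (Fin n) k ⧸ P := fun j => Ideal.Quotient.mk P (MvPolynomial.X j)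
  have htop : Algebra.adjoin k (Set.range f) = ⊤ := by
    have h := congrArg (Subalgebra.map (Ideal.Quotient.mkₐ k P)) (MvPolynomial.adjoin_range_X (R := k) (σ := Fin n))
    rw [AlgHom.map_adjoin, ← Set.range_comp, Algebra.map_top, (AlgHom.range_eq_top _).mpr (Ideal.Quotient.mkₐ_surjective k P)] at h
    exact h
  have : Algebra.IsAlgebraic (Algebra.adjoin k (Set.range f)) (MvPolynomial (Fin n) k ⧸ P) := by
    constructor
    intro y
    have hy : y ∈ Algebra.adjoin k (Set.range f) := by rw [htop]; trivial
    exact isAlgebraic_algebraMap (⟨y, hy⟩ : Algebra.adjoin k (Set.range f))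
  obtain ⟨t, ht, hb⟩ := exists_isTranscendenceBasis_subset (R := k) (Set.range f)
  obtain ⟨u, hu⟩ := Set.subset_range_iff_exists_image_eq.mp ht
  obtain ⟨v, hvu, hv⟩ := Set.exists_subset_bijOn u f
  rw [hu] at hv
  let S : Finset (Fin n) := v.toFinset
  let e : {l : Fin n // l ∈ S} ≃ t :=
    (Equiv.subtypeEquivRight (fun l => by simp [S])).trans hv.equiv
  have hbS : IsTranscendenceBasis k
      (fun j : {l : Fin n // l ∈ S} => Ideal.Quotient.mk P (MvPolynomial.X j.1)) := by
    have := hb.comp_equiv e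
    exact this
  refine ⟨S, hbS, ?_⟩
  have hc := hbS.lift_cardinalMk_eq_trdeg
  rw [← dpd_ht_trdeg k n P, ← Cardinal.toENat_lift, ← hc]
  simp
lemma dpd_pderiv_pow {n : ℕ} {k : Type*} [CommSemiring k] (i : Fin n) (t : ℕ) (β : Fin n →₀ ℕ) (c : k) :
    (((MvPolynomial.pderiv i).toLinearMap : Module.End k (MvPolynomial (Fin n) k)) ^ t) (monomial β c)
      = monomial (β - Finsupp.single i t) (c * ((β i).descFactorial t : k)) := by
  induction t with
  | zero => simp
  | succ t ih =>
    rw [pow_succ', Module.End.mul_apply, ih]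
    change pderiv i _ = _
    rw [pderiv_monomial, tsub_tsub, ← Finsupp.single_add, Nat.descFactorial_succ]
    simp only [Finsupp.coe_tsub, Pi.sub_apply, Finsupp.single_eq_same]
    push_cast
    rw [mul_assoc, mul_comm ((β i).descFactorial t : k)]

lemma dpd_list {n : ℕ} {k : Type*} [CommSemiring k] (α β : Fin n →₀ ℕ) (c : k) (l : List (Fin n))
    (hl : l.Nodup) :
    (l.map fun i => ((MvPolynomial.pderiv i).toLinearMap : Module.End k (MvPolynomial (Fin n) k)) ^ (α i)).prod
      (monomial β c)
      = monomial (β - (l.map fun i => Finsupp.single i (α i)).sum)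
        (c * (l.map fun i => ((β i).descFactorial (α i) : k)).prod) := by
  induction l with
  | nil => simp
  | cons i l ih =>
    rw [List.nodup_cons] at hl
    rw [List.map_cons, List.prod_cons, Module.End.mul_apply, ih hl.2, dpd_pderiv_pow]
    have h0 : ∀ l : List (Fin n), i ∉ l → (l.map fun i => Finsupp.single i (α i)).sum i = 0 := by
      intro l hl
      induction l with
      | nil => simp
      | cons j l ih =>
        simp only [List.mem_cons, not_or] at hl
        simp [ih hl.2, Ne.symm hl.1]
    simp only [Finsupp.coe_tsub, Pi.sub_apply, h0 l hl.1, List.map_cons, List.sum_cons, List.prod_cons, tsub_zero]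
    rw [tsub_tsub, add_comm]
    congr 1
    ring

lemma dpd_derivOp_monomial {n : ℕ} {k : Type*} [CommSemiring k] (α β : Fin n →₀ ℕ) (c : k) :
    derivOp α (monomial β c) = monomial (β - α) (c * ∏ i, ((β i).descFactorial (α i) : k)) := by
  unfold derivOp
  rw [List.ofFn_eq_map, dpd_list _ _ _ _ (List.nodup_finRange n)]
  have h1 : ((List.finRange n).map fun i => Finsupp.single i (α i)).sum = α := by
    rw [← List.ofFn_eq_map, List.sum_ofFn]
    exact Finsupp.univ_sum_single α
  rw [h1, ← List.ofFn_eq_map, List.prod_ofFn]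

lemma dpd_binom {B : Type*} [CommSemiring B] (a h : B) (c b : ℕ) (hc : h ^ c = 0) :
    (a + h) ^ b = ∑ t ∈ Finset.range c, (b.choose t : B) * a ^ (b - t) * h ^ t := by
  rw [add_comm, add_pow]
  have h1 : ∑ m ∈ Finset.range (b + 1), h ^ m * a ^ (b - m) * (b.choose m : B) =
      ∑ t ∈ Finset.range (max (b + 1) c), (b.choose t : B) * a ^ (b - t) * h ^ t := by
    rw [← Finset.sum_subset (s₁ := Finset.range (b+1)) (s₂ := Finset.range (max (b + 1) c))]
    · exact Finset.sum_congr rfl fun x _ => by ring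
    · simp
    · intro x _ hx
      rw [Nat.choose_eq_zero_of_lt (by simpa using hx)]; simp
  rw [h1]
  symm
  apply Finset.sum_subset
  · simp
  · intro x _ hx
    rw [pow_eq_zero_of_le (by simpa using hx) hc]; simp

/-- Box of multi-indices. -/
noncomputable def dpdBox {n : ℕ} (c : Fin n → ℕ) : Finset (Fin n →₀ ℕ) :=
  (Fintype.piFinset fun i => Finset.range (c i)).map Finsupp.equivFunOnFinite.symm.toEmbedding

lemma dpd_mem_box {n : ℕ} (c : Fin n → ℕ) (α : Fin n →₀ ℕ) : α ∈ dpdBox c ↔ ∀ i, α i < c i := by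
  simp only [dpdBox, Finset.mem_map, Fintype.mem_piFinset, Finset.mem_range]
  constructor
  · rintro ⟨f, hf, rfl⟩; exact hf
  · intro h; exact ⟨α, h, by ext; simp⟩

lemma dpd_taylor {n : ℕ} {k B : Type*} [Field k] [CharZero k] [CommRing B] [Algebra k B]
    (a h : Fin n → B) (c : Fin n → ℕ) (hc : ∀ i, h i ^ c i = 0) (f : MvPolynomial (Fin n) k) :
    aeval (a + h) f = ∑ α ∈ dpdBox c,
      algebraMap k B (∏ i, ((α i).factorial : k))⁻¹ * aeval a (derivOp α f) * ∏ i, h i ^ α i := by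
  induction f using MvPolynomial.induction_on' with
  | add f g hf hg =>
    simp only [map_add, hf, hg, mul_add, add_mul, Finset.sum_add_distrib]
  | monomial β b =>
    rw [aeval_monomial]
    simp only [dpd_derivOp_monomial, aeval_monomial]
    rw [Finsupp.prod_fintype _ _ (by simp)]
    simp only [Pi.add_apply, dpd_binom _ _ _ _ (hc _)]
    rw [Finset.prod_univ_sum, Finset.mul_sum, dpdBox, Finset.sum_map]
    refine Finset.sum_congr rfl fun α _ => ?_
    simp only [Equiv.coe_toEmbedding, Finsupp.equivFunOnFinite_symm_apply_apply]
    rw [Finsupp.prod_fintype _ _ (by simp)]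
    simp only [Finsupp.coe_tsub, Pi.sub_apply, Finsupp.equivFunOnFinite_symm_apply_apply]
    have h2 : (∏ i, ((α i).factorial : k))⁻¹ * (b * ∏ i, ((β i).descFactorial (α i) : k)) =
        b * ∏ i, ((β i).choose (α i) : k) := by
      simp only [Nat.descFactorial_eq_factorial_mul_choose, Nat.cast_mul, Finset.prod_mul_distrib]
      have : ∏ i, ((α i).factorial : k) ≠ 0 :=
        Finset.prod_ne_zero_iff.mpr fun i _ => by exact_mod_cast Nat.factorial_ne_zero _
      field_simp
    rw [← mul_assoc ((algebraMap k B) _), ← map_mul, h2, map_mul, map_prod]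
    simp only [map_natCast, Finset.prod_mul_distrib]
    ring

theorem dpd_lift {L F B : Type*} [Field L] [CharZero L] [Field F] [Algebra L F]
    [Algebra.IsAlgebraic L F] [CommRing B] [Algebra L B] (g : B →ₐ[L] F)
    (hg : Function.Surjective g) (hg' : IsNilpotent (RingHom.ker g)) :
    ∃ ι : F →ₐ[L] B, ∀ x, g (ι x) = x := by
  have : Algebra.IsSeparable L F := inferInstance
  have := Algebra.FormallyEtale.of_isSeparable L F
  exact ⟨Algebra.FormallySmooth.liftOfSurjective (AlgHom.id L F) g hg hg', fun x => by
    rw [Algebra.FormallySmooth.liftOfSurjective_apply]; rfl⟩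

theorem dpd_coeff {k : Type*} [Field k] [CharZero k] {n : ℕ}
    (p : Ideal (MvPolynomial (Fin n) k)) [p.IsPrime] (S : Finset (Fin n))
    (hS : IsTranscendenceBasis k
      (fun j : {l : Fin n // l ∈ S} => Ideal.Quotient.mk p (MvPolynomial.X j.1)))
    {F : Type*} [Field F] [Algebra (MvPolynomial (Fin n) k) F]
    [Algebra (MvPolynomial (Fin n) k ⧸ p) F]
    [IsScalarTower (MvPolynomial (Fin n) k) (MvPolynomial (Fin n) k ⧸ p) F]
    [IsFractionRing (MvPolynomial (Fin n) k ⧸ p) F]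
    {B : Type*} [CommRing B] [Algebra (MvPolynomial (Fin n) k) B]
    (g : B →ₐ[MvPolynomial (Fin n) k] F) (hg : Function.Surjective g)
    (hg' : IsNilpotent (RingHom.ker g)) :
    ∃ ι : F →+* B, (∀ f, g (ι f) = f) ∧
      (∀ c : k, ι (algebraMap (MvPolynomial (Fin n) k) F (MvPolynomial.C c)) =
        algebraMap (MvPolynomial (Fin n) k) B (MvPolynomial.C c)) ∧
      (∀ j ∈ S, ι (algebraMap (MvPolynomial (Fin n) k) F (MvPolynomial.X j)) =
        algebraMap (MvPolynomial (Fin n) k) B (MvPolynomial.X j)) := by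
  classical
  set R := MvPolynomial (Fin n) k with hR
  let Cp := MvPolynomial {l : Fin n // l ∈ S} k
  let L := FractionRing Cp
  let e : Cp →ₐ[k] R := MvPolynomial.rename Subtype.val
  have hker : ∀ x : R, algebraMap R F x = 0 ↔ x ∈ p := by
    intro x
    rw [IsScalarTower.algebraMap_apply R (R ⧸ p) F, Ideal.Quotient.algebraMap_eq]
    rw [map_eq_zero_iff _ (IsFractionRing.injective (R ⧸ p) F), Ideal.Quotient.eq_zero_iff_mem]
  have he : ∀ c : Cp, e c ∈ p → c = 0 := by
    intro c hc
    have h1 := hS.1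
    rw [algebraicIndependent_iff] at h1
    apply h1
    have h2 : (MvPolynomial.aeval
      (fun j : {l : Fin n // l ∈ S} => Ideal.Quotient.mk p (MvPolynomial.X j.1))) =
      (Ideal.Quotient.mkₐ k p).comp e := by
      ext j
      simp [e]
    rw [h2]
    exact Ideal.Quotient.eq_zero_iff_mem.2 hc
  have hunit : ∀ b : B, g b ≠ 0 → IsUnit b := by
    intro b hb
    obtain ⟨b', hb'⟩ := hg (g b)⁻¹
    have h1 : b * b' - 1 ∈ RingHom.ker g := by
      rw [RingHom.mem_ker, map_sub, map_mul, hb', mul_inv_cancel₀ hb, map_one, sub_self]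
    have h2 : IsNilpotent (b * b' - 1) := by
      obtain ⟨m, hm⟩ := hg'
      refine ⟨m, ?_⟩
      have := Ideal.pow_mem_pow h1 m
      rw [hm] at this
      simpa using this
    have h3 := h2.isUnit_one_add
    rw [add_sub_cancel] at h3
    exact isUnit_of_mul_isUnit_left h3
  have hu : ∀ y : nonZeroDivisors Cp, IsUnit (((algebraMap R B).comp e.toRingHom) y) := by
    intro y
    apply hunit
    have h0 : (y : Cp) ≠ 0 := nonZeroDivisors.ne_zero y.2
    intro h
    apply h0
    apply he
    rw [← hker]
    rw [← h]
    exact (g.commutes _).symm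
  let ψ : L →+* B := IsLocalization.lift (M := nonZeroDivisors Cp) hu
  have hψ : ∀ c : Cp, ψ (algebraMap Cp L c) = algebraMap R B (e c) := by
    intro c
    exact IsLocalization.lift_eq hu c
  let _ : Algebra L B := ψ.toAlgebra
  let _ : Algebra L F := ((g : B →+* F).comp ψ).toAlgebra
  have hLF : ∀ x : L, algebraMap L F x = g (ψ x) := fun _ => rfl
  let gL : B →ₐ[L] F := { (g : B →+* F) with commutes' := fun _ => rfl }
  have hchar : CharZero L := charZero_of_injective_algebraMap (R := k)
    ((IsFractionRing.injective Cp L).comp (MvPolynomial.C_injective _ _))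
  let _ : Algebra k F := ((algebraMap R F).comp (algebraMap k R)).toAlgebra
  have _ : IsScalarTower k R F := IsScalarTower.of_algebraMap_eq' rfl
  have _ : IsScalarTower k (R ⧸ p) F := IsScalarTower.to₁₃₄ k R (R ⧸ p) F
  have _ : Algebra.IsAlgebraic (R ⧸ p) F :=
    IsLocalization.isAlgebraic F (nonZeroDivisors (R ⧸ p))
  have halg : Algebra.IsAlgebraic L F := by
    have hF := hS.algebraMap_comp (A := F)
    have hA := hF.isAlgebraic
    constructor
    intro y
    have hy := hA.isAlgebraic y
    refine hy.ringHom_of_comp_eq ((algebraMap Cp L).comp (hF.1.aevalEquiv.symm : _ →+* Cp))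
      (RingHom.id F) ?_ ?_
    · exact (IsFractionRing.injective Cp L).comp hF.1.aevalEquiv.symm.injective
    · apply RingHom.ext
      intro z
      obtain ⟨c, rfl⟩ := hF.1.aevalEquiv.surjective z
      simp only [RingHom.coe_comp, Function.comp_apply, RingHom.id_apply, RingHom.coe_coe,
        AlgEquiv.symm_apply_apply]
      rw [hLF, hψ, AlgHom.commutes, hF.1.algebraMap_aevalEquiv]
      change _ = (MvPolynomial.aeval _) c
      have h2 : (MvPolynomial.aeval ((algebraMap (R ⧸ p) F) ∘
        (fun j : {l : Fin n // l ∈ S} => Ideal.Quotient.mk p (MvPolynomial.X j.1)))) =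
        (IsScalarTower.toAlgHom k R F).comp e := by
        ext j
        simp only [MvPolynomial.aeval_X, Function.comp_apply, AlgHom.comp_apply, e,
          IsScalarTower.toAlgHom_apply]
        rw [MvPolynomial.rename_X, IsScalarTower.algebraMap_apply R (R ⧸ p) F]
        rfl
      rw [h2]
      rfl
  obtain ⟨ι, hι⟩ := dpd_lift gL hg hg'
  have key : ∀ c : Cp, ι (algebraMap R F (e c)) = algebraMap R B (e c) := by
    intro c
    have := ι.commutes (algebraMap Cp L c)
    rw [hLF, hψ, AlgHom.commutes] at this
    rw [this]
    exact hψ c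
  refine ⟨ι, hι, ?_, ?_⟩
  · intro c
    have h1 : e (MvPolynomial.C c) = MvPolynomial.C c := MvPolynomial.rename_C _ _
    have := key (MvPolynomial.C c)
    rwa [h1] at this
  · intro j hj
    have h1 : e (MvPolynomial.X ⟨j, hj⟩) = MvPolynomial.X j := MvPolynomial.rename_X _ _
    have := key (MvPolynomial.X ⟨j, hj⟩)
    rwa [h1] at this

theorem dpd_length {F B : Type*} [Field F] [CommRing B] [Algebra F B] (g : B →ₐ[F] F)
    (hg' : IsNilpotent (RingHom.ker g)) {G : Type*} [AddCommGroup G] [Module B G]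
    (hG : IsFiniteLength B G) :
    ∀ [Module F G] [IsScalarTower F B G], Module.length F G = Module.length B G := by
  have hbig : ∀ {G : Type _} [AddCommGroup G] [Module B G] [Module F G] [IsScalarTower F B G]
      [IsSimpleModule B G], IsSimpleModule F G := by
    intro G _ _ _ _ hs
    have hnon : Nontrivial G := IsSimpleModule.nontrivial B G
    have hann : ∀ b : B, g b = 0 → ∀ x : G, b • x = 0 := by
      intro b hb x
      have hnil : IsNilpotent b := by
        obtain ⟨m, hm⟩ := hg'
        refine ⟨m, ?_⟩
        have := Ideal.pow_mem_pow (RingHom.mem_ker.2 hb) m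
        rw [hm] at this
        simpa using this
      have hmax : (Module.annihilator B G).IsMaximal := IsSimpleModule.annihilator_isMaximal
      have := hmax.isPrime
      obtain ⟨m, hm⟩ := hnil
      have hb2 : b ∈ Module.annihilator B G :=
        this.mem_of_pow_mem m (by rw [hm]; exact zero_mem _)
      exact Module.mem_annihilator.1 hb2 x
    have hact : ∀ (b : B) (x : G), b • x = g b • x := by
      intro b x
      have h1 := hann (b - algebraMap F B (g b)) (by simp) x
      rw [sub_smul, sub_eq_zero, algebraMap_smul] at h1
      exact h1
    rw [isSimpleModule_iff]
    refine ⟨fun W => ?_⟩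
    let W' : Submodule B G := { W with
      smul_mem' := fun b x hx => by
        rw [hact]
        exact W.smul_mem _ hx }
    rcases eq_bot_or_eq_top W' with h | h
    · left
      ext x
      have : x ∈ W' ↔ x ∈ (⊥ : Submodule B G) := by rw [h]
      rw [Submodule.mem_bot] at this ⊢
      exact this
    · right
      ext x
      have : x ∈ W' ↔ x ∈ (⊤ : Submodule B G) := by rw [h]
      exact this.trans ⟨fun _ => trivial, fun _ => trivial⟩
  induction hG with
  | of_subsingleton => intro _ _; rw [Module.length_eq_zero, Module.length_eq_zero]
  | @of_simple_quotient M _ _ N hs hN ih =>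
    intro _ _
    have h1 := Module.length_eq_add_of_exact (R := B) N.subtype N.mkQ N.subtype_injective
      N.mkQ_surjective (LinearMap.exact_subtype_mkQ N)
    have h2 := Module.length_eq_add_of_exact (R := F) (N.subtype.restrictScalars F)
      (N.mkQ.restrictScalars F) N.subtype_injective
      N.mkQ_surjective (LinearMap.exact_subtype_mkQ N)
    have h3 : IsSimpleModule F (M ⧸ N) := hbig
    rw [h1, h2, ih, Module.length_eq_one F (M ⧸ N), Module.length_eq_one B (M ⧸ N)]

theorem dpd_expand {k : Type*} [Field k] [CharZero k] {n : ℕ} (S : Finset (Fin n))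
    {F : Type*} [Field F] [Algebra (MvPolynomial (Fin n) k) F]
    {B : Type*} [CommRing B] [Algebra (MvPolynomial (Fin n) k) B]
    (g : B →ₐ[MvPolynomial (Fin n) k] F) (m : ℕ) (hm : RingHom.ker g ^ m = ⊥)
    (ι : F →+* B) (hι : ∀ f, g (ι f) = f)
    (hC : ∀ c : k, ι (algebraMap (MvPolynomial (Fin n) k) F (MvPolynomial.C c)) =
        algebraMap (MvPolynomial (Fin n) k) B (MvPolynomial.C c))
    (hX : ∀ j ∈ S, ι (algebraMap (MvPolynomial (Fin n) k) F (MvPolynomial.X j)) =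
        algebraMap (MvPolynomial (Fin n) k) B (MvPolynomial.X j)) :
    ∃ (T : Finset (Fin n →₀ ℕ)) (u : (Fin n →₀ ℕ) → B),
      (∀ α ∈ T, ∀ l ∈ S, α l = 0) ∧
      ∀ f : MvPolynomial (Fin n) k, algebraMap (MvPolynomial (Fin n) k) B f =
        ∑ α ∈ T, ι (algebraMap (MvPolynomial (Fin n) k) F (derivOp α f)) * u α := by
  classical
  let _ : Algebra k B := ((algebraMap (MvPolynomial (Fin n) k) B).comp MvPolynomial.C).toAlgebra
  have hkB : ∀ c : k, algebraMap k B c = algebraMap (MvPolynomial (Fin n) k) B (MvPolynomial.C c) :=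
    fun _ => rfl
  let a : Fin n → B := fun i => ι (algebraMap (MvPolynomial (Fin n) k) F (MvPolynomial.X i))
  let h : Fin n → B := fun i => algebraMap (MvPolynomial (Fin n) k) B (MvPolynomial.X i) - a i
  let c : Fin n → ℕ := fun i => if i ∈ S then 1 else m
  have hc : ∀ i, h i ^ c i = 0 := by
    intro i
    by_cases hi : i ∈ S
    · simp [c, hi, h, a, hX i hi]
    · have h1 : h i ∈ RingHom.ker g := by
        rw [RingHom.mem_ker]
        simp only [h, a, map_sub, hι, AlgHom.commutes, sub_self]
      have h2 := Ideal.pow_mem_pow h1 m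
      rw [hm] at h2
      simpa [c, hi] using h2
  refine ⟨dpdBox c, fun α => algebraMap k B (∏ i, ((α i).factorial : k))⁻¹ * ∏ i, h i ^ α i,
    ?_, ?_⟩
  · intro α hα l hl
    have := ((dpd_mem_box c α).1 hα) l
    simp only [c, hl, if_true] at this
    omega
  · intro f
    have ht := dpd_taylor a h c hc f
    have h1 : ∀ q : MvPolynomial (Fin n) k, MvPolynomial.aeval (a + h) q =
        algebraMap (MvPolynomial (Fin n) k) B q := by
      intro q
      have : a + h = fun i => algebraMap (MvPolynomial (Fin n) k) B (MvPolynomial.X i) := by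
        funext i; simp [h]
      rw [this]
      induction q using MvPolynomial.induction_on with
      | C c => rw [← MvPolynomial.algebraMap_eq, AlgHom.commutes]; rfl
      | add p q hp hq => simp [hp, hq]
      | mul_X p i hp => simp [hp]
    have h2 : ∀ q : MvPolynomial (Fin n) k, MvPolynomial.aeval a q =
        ι (algebraMap (MvPolynomial (Fin n) k) F q) := by
      intro q
      induction q using MvPolynomial.induction_on with
      | C c => rw [hC, ← MvPolynomial.algebraMap_eq, AlgHom.commutes]; rfl
      | add p q hp hq => simp [hp, hq]
      | mul_X p i hp => simp [hp, a]
    rw [h1] at ht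
    rw [ht]
    refine Finset.sum_congr rfl fun α _ => ?_
    rw [h2]
    ring

theorem dpd_dense {R F B N : Type*} [CommRing R] [Field F] [Algebra R F] [CommRing B] [Algebra R B]
    [Algebra F B] (g : B →ₐ[R] F) (m : ℕ) (hm : RingHom.ker g ^ m = ⊥)
    (hι : ∀ f, g (algebraMap F B f) = f) [AddCommGroup N] [Module R N] [Module B N] [Module F N]
    [IsScalarTower R B N] [IsScalarTower F B N] (W : Submodule R N)
    (hW : ∀ x : N, ∃ s : R, algebraMap R F s ≠ 0 ∧ s • x ∈ W) (φ : N →ₗ[F] F)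
    (hφ : ∀ x ∈ W, φ x = 0) : φ = 0 := by
  let E : Submodule F N := Submodule.span F (W : Set N)
  have hE : ∀ x ∈ E, φ x = 0 := by
    intro x hx
    have : E ≤ LinearMap.ker φ := Submodule.span_le.2 fun y hy => hφ y hy
    exact this hx
  have hER : ∀ (s : R), ∀ x ∈ E, algebraMap R B s • x ∈ E := by
    intro s x hx
    induction hx using Submodule.span_induction with
    | mem x hx => rw [algebraMap_smul]; exact Submodule.subset_span (W.smul_mem s hx)
    | zero => rw [smul_zero]; exact zero_mem _
    | add x y _ _ hx hy => rw [smul_add]; exact add_mem hx hy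
    | smul a x _ hx =>
      rw [← algebraMap_smul B a x, smul_comm, algebraMap_smul]
      exact E.smul_mem _ hx
  ext x
  rw [LinearMap.zero_apply]
  obtain ⟨s, hs, hsx⟩ := hW x
  set σ := algebraMap R B s
  set a := algebraMap F B (algebraMap R F s) with ha
  have haE : ∀ y ∈ E, a • y ∈ E := by
    intro y hy
    rw [ha, algebraMap_smul]
    exact E.smul_mem _ hy
  have hσx : σ • x ∈ E := by
    rw [algebraMap_smul]; exact Submodule.subset_span hsx
  have haE' : ∀ i, ∀ y ∈ E, a ^ i • y ∈ E := by
    intro i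
    induction i with
    | zero => intro y hy; simpa using hy
    | succ i ih => intro y hy; rw [pow_succ, mul_smul]; exact ih _ (haE y hy)
  have key : ∀ i, (a - σ) ^ i • x - a ^ i • x ∈ E := by
    intro i
    induction i with
    | zero => simp
    | succ i ih =>
      have : (a - σ) ^ (i + 1) • x - a ^ (i + 1) • x =
          (a • ((a - σ) ^ i • x - a ^ i • x) - σ • ((a - σ) ^ i • x - a ^ i • x))
            - a ^ i • σ • x := by
        module
      rw [this]
      exact sub_mem (sub_mem (haE _ ih) (hER _ _ ih)) (haE' _ _ hσx)
  have h0 : (a - σ) ^ m = 0 := by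
    have h1 : a - σ ∈ RingHom.ker g := by
      rw [RingHom.mem_ker, map_sub, ha, hι, AlgHom.commutes, sub_self]
    have h2 := Ideal.pow_mem_pow h1 m
    rw [hm] at h2
    simpa using h2
  have h1 := hE _ (key m)
  rw [h0, zero_smul, zero_sub, map_neg, neg_eq_zero, ha, ← map_pow, algebraMap_smul,
    map_smul, smul_eq_mul] at h1
  exact (mul_eq_zero.1 h1).resolve_left (pow_ne_zero _ hs)

theorem dpd_act {k : Type*} [Field k] {n r : ℕ} (T : Finset (Fin n →₀ ℕ))
    (c : Fin r → (Fin n →₀ ℕ) → MvPolynomial (Fin n) k)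
    (w : Fin r → MvPolynomial (Fin n) k) :
    DiffOp.act (fun j => Finsupp.indicator T (fun α _ => c j α) : DiffOp n k r) w =
      ∑ j, ∑ α ∈ T, c j α * derivOp α (w j) := by
  classical
  unfold DiffOp.act
  rw [LinearMap.sum_apply]
  refine Finset.sum_congr rfl fun j _ => ?_
  rw [Finsupp.sum_of_support_subset _ (Finsupp.support_indicator_subset _ _) _ (by simp),
    LinearMap.sum_apply]
  refine Finset.sum_congr rfl fun α hα => ?_
  rw [Finsupp.indicator_of_mem hα]
  simp

theorem dpd_core {k : Type*} [Field k] [CharZero k] {n r : ℕ}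
    (p : Ideal (MvPolynomial (Fin n) k)) [p.IsPrime] (S : Finset (Fin n))
    (hS : IsTranscendenceBasis k
      (fun j : {l : Fin n // l ∈ S} => Ideal.Quotient.mk p (MvPolynomial.X j.1)))
    {F : Type*} [Field F] [Algebra (MvPolynomial (Fin n) k) F]
    [Algebra (MvPolynomial (Fin n) k ⧸ p) F]
    [IsScalarTower (MvPolynomial (Fin n) k) (MvPolynomial (Fin n) k ⧸ p) F]
    [IsFractionRing (MvPolynomial (Fin n) k ⧸ p) F]
    {B : Type*} [CommRing B] [Algebra (MvPolynomial (Fin n) k) B]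
    (g : B →ₐ[MvPolynomial (Fin n) k] F) (hg : Function.Surjective g)
    (m : ℕ) (hm : RingHom.ker g ^ m = ⊥)
    {N : Type*} [AddCommGroup N] [Module (MvPolynomial (Fin n) k) N] [Module B N]
    [IsScalarTower (MvPolynomial (Fin n) k) B N]
    (e : (Fin r → MvPolynomial (Fin n) k) →ₗ[MvPolynomial (Fin n) k] N)
    (he : ∀ x : N, ∃ s ∉ p, s • x ∈ LinearMap.range e)
    (G : Submodule B N) (hG : IsFiniteLength B G) :
    ∃ A : Finset (DiffOp n k r), (A.card : ℕ∞) = Module.length B G ∧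
      (∀ δ ∈ A, DiffOp.InRelWeylSet S δ) ∧
      (∀ w, e w = 0 → ∀ δ ∈ A, DiffOp.act δ w ∈ p) ∧
      (∀ w, e w ∈ G → (∀ δ ∈ A, DiffOp.act δ w ∈ p) → e w = 0) := by
  classical
  have hker : ∀ x : MvPolynomial (Fin n) k,
      algebraMap (MvPolynomial (Fin n) k) F x = 0 ↔ x ∈ p := by
    intro x
    rw [IsScalarTower.algebraMap_apply _ (MvPolynomial (Fin n) k ⧸ p) F,
      Ideal.Quotient.algebraMap_eq,
      map_eq_zero_iff _ (IsFractionRing.injective (MvPolynomial (Fin n) k ⧸ p) F),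
      Ideal.Quotient.eq_zero_iff_mem]
  obtain ⟨ι, hι, hC, hX⟩ := dpd_coeff p S hS g hg ⟨m, hm⟩
  obtain ⟨T, u, hT, hu⟩ := dpd_expand S g m hm ι hι hC hX
  let _ : Algebra F B := ι.toAlgebra
  let _ : Module F N := Module.compHom N ι
  have _ : IsScalarTower F B N := IsScalarTower.of_algebraMap_smul fun _ _ => rfl
  let gF : B →ₐ[F] F := { (g : B →+* F) with commutes' := fun x => hι x }
  have hlen : Module.length F G = Module.length B G := dpd_length gF ⟨m, hm⟩ hG
  have hfinF : IsFiniteLength F G := by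
    rw [← Module.length_ne_top_iff, hlen, Module.length_ne_top_iff]
    exact hG
  have hnoeth := (isFiniteLength_iff_isNoetherian_isArtinian.1 hfinF).1
  have _ : Module.Finite F G := inferInstance
  let b := Module.finBasis F G
  have hφ : ∀ t, ∃ φ : N →ₗ[F] F, ∀ x : G, φ x = b.coord t x := by
    intro t
    obtain ⟨φ, hφ⟩ := LinearMap.exists_extend (p := G.restrictScalars F) (b.coord t)
    exact ⟨φ, fun x => LinearMap.congr_fun hφ x⟩
  choose φ hφ using hφ
  let κ : Fin (Module.finrank F G) × Fin r × T → F := fun x =>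
    φ x.1 (u x.2.2.1 • e (Pi.single x.2.1 1))
  obtain ⟨s, hs⟩ := IsLocalization.exist_integer_multiples_of_finite
    (nonZeroDivisors (MvPolynomial (Fin n) k ⧸ p)) κ
  obtain ⟨s', hs'⟩ := Ideal.Quotient.mk_surjective (s : MvPolynomial (Fin n) k ⧸ p)
  have hs0 : algebraMap (MvPolynomial (Fin n) k) F s' ≠ 0 := by
    rw [Ne, hker, ← Ideal.Quotient.eq_zero_iff_mem, hs']
    exact nonZeroDivisors.ne_zero s.2
  have hnum : ∀ x, ∃ q : MvPolynomial (Fin n) k, algebraMap (MvPolynomial (Fin n) k) F q =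
      algebraMap (MvPolynomial (Fin n) k) F s' * κ x := by
    intro x
    obtain ⟨q, hq⟩ := hs x
    obtain ⟨q', rfl⟩ := Ideal.Quotient.mk_surjective q
    refine ⟨q', ?_⟩
    rw [IsScalarTower.algebraMap_apply _ (MvPolynomial (Fin n) k ⧸ p) F,
      IsScalarTower.algebraMap_apply _ (MvPolynomial (Fin n) k ⧸ p) F s',
      Ideal.Quotient.algebraMap_eq, hq, hs']
    exact Algebra.smul_def _ _
  choose q hq using hnum
  let cf : Fin (Module.finrank F G) → Fin r → (Fin n →₀ ℕ) → MvPolynomial (Fin n) k :=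
    fun t j α => if h : α ∈ T then q (t, j, ⟨α, h⟩) else 0
  let δ : Fin (Module.finrank F G) → DiffOp n k r := fun t j =>
    Finsupp.indicator T (fun α _ => cf t j α)
  have hδ : ∀ t w, algebraMap (MvPolynomial (Fin n) k) F (DiffOp.act (δ t) w) =
      algebraMap (MvPolynomial (Fin n) k) F s' * φ t (e w) := by
    intro t w
    have hw : e w = ∑ j, ∑ α ∈ T, algebraMap (MvPolynomial (Fin n) k) F (derivOp α (w j)) •
        (u α • e (Pi.single j 1)) := by
      have h1 : w = ∑ j, w j • (Pi.single j 1 : Fin r → MvPolynomial (Fin n) k) := by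
        funext i
        simp [Finset.sum_apply, Pi.single_apply]
      conv_lhs => rw [h1]
      rw [map_sum]
      refine Finset.sum_congr rfl fun j _ => ?_
      rw [map_smul, ← algebraMap_smul B (w j), hu, Finset.sum_smul]
      refine Finset.sum_congr rfl fun α _ => ?_
      rw [mul_smul]
      rfl
    rw [hw, dpd_act]
    simp only [map_sum, map_mul, map_smul, Finset.mul_sum, smul_eq_mul]
    refine Finset.sum_congr rfl fun j _ => Finset.sum_congr rfl fun α hα => ?_
    have : cf t j α = q (t, j, ⟨α, hα⟩) := by simp [cf, hα]
    rw [this, hq]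
    simp only [κ]
    ring
  have hmem : ∀ t w, DiffOp.act (δ t) w ∈ p ↔ φ t (e w) = 0 := by
    intro t w
    rw [← hker, hδ, mul_eq_zero, or_iff_right hs0]
  have hinj : Function.Injective δ := by
    intro t t' htt
    have h1 : φ t - φ t' = 0 := by
      refine dpd_dense g m hm hι (LinearMap.range e) ?_ _ ?_
      · intro x
        obtain ⟨s, hs, hx⟩ := he x
        exact ⟨s, fun h => hs ((hker s).1 h), hx⟩
      · rintro x ⟨w, rfl⟩
        have h2 := hδ t w
        rw [htt, hδ t' w] at h2
        rw [LinearMap.sub_apply, mul_left_cancel₀ hs0 h2, sub_self]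
    by_contra hne
    have h2 := LinearMap.congr_fun h1 (b t : N)
    rw [LinearMap.sub_apply, hφ, hφ] at h2
    simp [hne] at h2
  refine ⟨Finset.univ.image δ, ?_, ?_, ?_, ?_⟩
  · rw [Finset.card_image_of_injective _ hinj, ← hlen, Module.length_eq_finrank]
    simp
  · intro d hd
    obtain ⟨t, -, rfl⟩ := Finset.mem_image.1 hd
    intro j α hα l hl
    exact hT α (Finsupp.support_indicator_subset _ _ hα) l hl
  · intro w hw d hd
    obtain ⟨t, -, rfl⟩ := Finset.mem_image.1 hd
    rw [hmem, hw, map_zero]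
  · intro w hw h
    have h1 : (⟨e w, hw⟩ : G) = 0 := by
      apply b.ext_elem
      intro t
      have h2 := (hmem t w).1 (h _ (Finset.mem_image_of_mem _ (Finset.mem_univ t)))
      have h3 := hφ t ⟨e w, hw⟩
      rw [h2] at h3
      simpa using h3.symm
    exact congrArg Subtype.val h1

theorem dpd_gamma {O M : Type*} [CommRing O] [IsNoetherianRing O] [IsLocalRing O]
    [AddCommGroup M] [Module O M] [Module.Finite O M] (I : Ideal O)
    (Γ : Submodule O M)
    (hΓ : Γ = ⨆ j : ℕ, Submodule.torsionBySet O M ((I ^ j : Ideal O) : Set O)) :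
    (∀ x, x ∈ Γ ↔ ∃ j : ℕ, ∀ a ∈ I ^ j, a • x = 0) ∧
    ∃ m : ℕ, ∀ x ∈ Γ, x ∈ (I ^ (m + 1) • ⊤ : Submodule O M) → x = 0 := by
  let f : ℕ →o Submodule O M := ⟨fun j => Submodule.torsionBySet O M ((I ^ j : Ideal O) : Set O),
    fun i j hij => Submodule.torsionBySet_le_torsionBySet_of_subset (Ideal.pow_le_pow_right hij)⟩
  have hmem : ∀ j x, x ∈ f j ↔ ∀ a ∈ I ^ j, a • x = 0 := by
    intro j x
    exact (Submodule.mem_torsionBySet_iff _ _).trans ⟨fun h a ha => h ⟨a, ha⟩, fun h a => h a a.2⟩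
  have h1 : ∀ x, x ∈ Γ ↔ ∃ j : ℕ, ∀ a ∈ I ^ j, a • x = 0 := by
    intro x
    have hΓ' : Γ = iSup f := hΓ
    rw [hΓ', Submodule.mem_iSup_of_directed _ f.monotone.directed_le]
    exact exists_congr fun j => hmem j x
  refine ⟨h1, ?_⟩
  obtain ⟨j, hj⟩ := monotone_stabilizes_iff_noetherian.2 (inferInstance : IsNoetherian O M) f
  have hle : ∀ x ∈ Γ, x ∈ f j := by
    intro x hx
    obtain ⟨i, hi⟩ := (h1 x).1 hx
    rw [← hmem] at hi
    rcases le_total i j with h | h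
    · exact f.monotone h hi
    · rw [hj i h]; exact hi
  obtain ⟨c, hc⟩ := Ideal.exists_pow_inf_eq_pow_smul I Γ
  refine ⟨c + j, fun x hx hx' => ?_⟩
  have h2 : x ∈ (I ^ (c + j + 1) • ⊤ : Submodule O M) ⊓ Γ := ⟨hx', hx⟩
  rw [hc _ (by omega)] at h2
  have h3 : (I ^ (c + j + 1 - c) • (I ^ c • ⊤ ⊓ Γ) : Submodule O M) ≤ ⊥ := by
    rw [Submodule.smul_le]
    intro a ha y hy
    have := (hmem j y).1 (hle y hy.2) a (Ideal.pow_le_pow_right (by omega) ha)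
    rw [this]
    exact zero_mem _
  simpa using h3 h2

theorem dpd_artin {O : Type*} [CommRing O] [IsNoetherianRing O] [IsLocalRing O] (I : Ideal O)
    (hI : I = IsLocalRing.maximalIdeal O) (m : ℕ) :
    IsArtinianRing (O ⧸ I ^ (m + 1)) := by
  subst hI
  have hne : (IsLocalRing.maximalIdeal O) ^ (m + 1) ≠ ⊤ := by
    intro h
    have := Ideal.pow_le_self (I := IsLocalRing.maximalIdeal O) (n := m + 1) (by omega)
    rw [h] at this
    exact (IsLocalRing.maximalIdeal.isMaximal O).ne_top (top_le_iff.1 this)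
  have _ : Nontrivial (O ⧸ (IsLocalRing.maximalIdeal O) ^ (m + 1)) :=
    Ideal.Quotient.nontrivial_iff.2 hne
  have _ : IsLocalRing (O ⧸ (IsLocalRing.maximalIdeal O) ^ (m + 1)) :=
    IsLocalRing.of_surjective' (Ideal.Quotient.mk _) Ideal.Quotient.mk_surjective
  rw [isArtinianRing_iff_isNilpotent_maximalIdeal]
  refine ⟨m + 1, ?_⟩
  have h1 : IsLocalRing.maximalIdeal (O ⧸ (IsLocalRing.maximalIdeal O) ^ (m + 1)) ≤
      (IsLocalRing.maximalIdeal O).map (Ideal.Quotient.mk _) := by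
    intro x hx
    obtain ⟨y, rfl⟩ := Ideal.Quotient.mk_surjective x
    apply Ideal.mem_map_of_mem
    rw [IsLocalRing.mem_maximalIdeal, mem_nonunits_iff] at hx ⊢
    exact fun h => hx (h.map _)
  have h2 := Ideal.pow_right_mono h1 (m + 1)
  rw [← Ideal.map_pow, Ideal.map_quotient_self] at h2
  exact le_bot_iff.1 h2

theorem dpd_mid {k : Type*} [Field k] [CharZero k] {n r : ℕ}
    (p : Ideal (MvPolynomial (Fin n) k)) [p.IsPrime] (S : Finset (Fin n))
    (hS : IsTranscendenceBasis k
      (fun j : {l : Fin n // l ∈ S} => Ideal.Quotient.mk p (MvPolynomial.X j.1)))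
    {F : Type*} [Field F] [Algebra (MvPolynomial (Fin n) k) F]
    [Algebra (MvPolynomial (Fin n) k ⧸ p) F]
    [IsScalarTower (MvPolynomial (Fin n) k) (MvPolynomial (Fin n) k ⧸ p) F]
    [IsFractionRing (MvPolynomial (Fin n) k ⧸ p) F]
    {B : Type*} [CommRing B] [Algebra (MvPolynomial (Fin n) k) B]
    (g : B →ₐ[MvPolynomial (Fin n) k] F) (hg : Function.Surjective g)
    (m : ℕ) (hm : RingHom.ker g ^ m = ⊥) [IsArtinianRing B]
    {O : Type*} [CommRing O] [Algebra (MvPolynomial (Fin n) k) O] [Algebra O B]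
    (hOB : Function.Surjective (algebraMap O B))
    {N : Type*} [AddCommGroup N] [Module (MvPolynomial (Fin n) k) N] [Module B N] [Module O N]
    [IsScalarTower (MvPolynomial (Fin n) k) B N] [IsScalarTower O B N]
    [IsScalarTower (MvPolynomial (Fin n) k) O N]
    {M : Type*} [AddCommGroup M] [Module (MvPolynomial (Fin n) k) M] [Module O M]
    [IsScalarTower (MvPolynomial (Fin n) k) O M] [Module.Finite O M]
    (em : (Fin r → MvPolynomial (Fin n) k) →ₗ[MvPolynomial (Fin n) k] M)
    (hem : ∀ x : M, ∃ s ∉ p, s • x ∈ LinearMap.range em)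
    (mkN : M →ₗ[O] N) (hmkN : Function.Surjective mkN)
    (Γ : Submodule O M) (hΓ : ∀ x ∈ Γ, mkN x = 0 → x = 0) :
    ∃ A : Finset (DiffOp n k r), (A.card : ℕ∞) = Module.length O Γ ∧
      (∀ δ ∈ A, DiffOp.InRelWeylSet S δ) ∧
      (∀ w, em w = 0 → ∀ δ ∈ A, DiffOp.act δ w ∈ p) ∧
      (∀ w, em w ∈ Γ → (∀ δ ∈ A, DiffOp.act δ w ∈ p) → em w = 0) := by
  let e : (Fin r → MvPolynomial (Fin n) k) →ₗ[MvPolynomial (Fin n) k] N :=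
    (mkN.restrictScalars (MvPolynomial (Fin n) k)) ∘ₗ em
  have he : ∀ x : N, ∃ s ∉ p, s • x ∈ LinearMap.range e := by
    intro x
    obtain ⟨y, rfl⟩ := hmkN x
    obtain ⟨s, hs, w, hw⟩ := hem y
    refine ⟨s, hs, w, ?_⟩
    change mkN (em w) = s • mkN y
    rw [hw]
    exact (mkN.restrictScalars (MvPolynomial (Fin n) k)).map_smul s y
  let G : Submodule B N :=
    { carrier := mkN '' Γ
      add_mem' := by
        rintro _ _ ⟨x, hx, rfl⟩ ⟨y, hy, rfl⟩
        exact ⟨x + y, Γ.add_mem hx hy, map_add _ _ _⟩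
      zero_mem' := ⟨0, Γ.zero_mem, map_zero _⟩
      smul_mem' := by
        rintro b _ ⟨x, hx, rfl⟩
        obtain ⟨o, rfl⟩ := hOB b
        exact ⟨o • x, Γ.smul_mem o hx, by rw [algebraMap_smul, map_smul]⟩ }
  let eqv0 : Γ →ₗ[O] G :=
    { toFun := fun x => ⟨mkN x, x, x.2, rfl⟩
      map_add' := fun x y => Subtype.ext (map_add mkN _ _)
      map_smul' := fun o x => Subtype.ext (map_smul mkN o x.1) }
  have hbij : Function.Bijective eqv0 := by
    constructor
    · rw [← LinearMap.ker_eq_bot, LinearMap.ker_eq_bot']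
      intro x hx
      apply Subtype.ext
      exact hΓ x x.2 (congrArg Subtype.val hx)
    · rintro ⟨_, x, hx, rfl⟩
      exact ⟨⟨x, hx⟩, rfl⟩
  have hlen1 : Module.length O Γ = Module.length O G :=
    (LinearEquiv.ofBijective eqv0 hbij).length_eq
  have hlen2 : Module.length O G = Module.length B G :=
    Module.length_eq_of_surjective (S := O) (R := B) hOB
  have _ : Module.Finite O N := Module.Finite.of_surjective mkN hmkN
  have _ : Module.Finite B N := Module.Finite.of_restrictScalars_finite O B N
  have hfin : IsFiniteLength B G :=
    isFiniteLength_iff_isNoetherian_isArtinian.2 ⟨inferInstance, inferInstance⟩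
  obtain ⟨A, hA1, hA2, hA3, hA4⟩ := dpd_core p S hS g hg m hm e he G hfin
  refine ⟨A, ?_, hA2, ?_, ?_⟩
  · rw [hA1, hlen1, hlen2]
  · intro w hw
    apply hA3
    change mkN (em w) = 0
    rw [hw, map_zero]
  · intro w h1 hw
    exact hΓ _ h1 (hA4 w ⟨_, h1, rfl⟩ hw)

theorem dpd_mid2 {k : Type*} [Field k] [CharZero k] {n r : ℕ}
    (p : Ideal (MvPolynomial (Fin n) k)) [p.IsPrime] (S : Finset (Fin n))
    (hS : IsTranscendenceBasis k
      (fun j : {l : Fin n // l ∈ S} => Ideal.Quotient.mk p (MvPolynomial.X j.1)))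
    {F : Type*} [Field F] [Algebra (MvPolynomial (Fin n) k) F]
    [Algebra (MvPolynomial (Fin n) k ⧸ p) F]
    [IsScalarTower (MvPolynomial (Fin n) k) (MvPolynomial (Fin n) k ⧸ p) F]
    [IsFractionRing (MvPolynomial (Fin n) k ⧸ p) F]
    {O : Type*} [CommRing O] [Algebra (MvPolynomial (Fin n) k) O]
    [IsNoetherianRing O] [IsLocalRing O]
    (ρ : O →ₐ[MvPolynomial (Fin n) k] F) (hρ : Function.Surjective ρ)
    (I : Ideal O) (hI : I = IsLocalRing.maximalIdeal O) (hρI : ∀ x, ρ x = 0 ↔ x ∈ I)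
    {M : Type*} [AddCommGroup M] [Module (MvPolynomial (Fin n) k) M] [Module O M]
    [IsScalarTower (MvPolynomial (Fin n) k) O M] [Module.Finite O M]
    (em : (Fin r → MvPolynomial (Fin n) k) →ₗ[MvPolynomial (Fin n) k] M)
    (hem : ∀ x : M, ∃ s ∉ p, s • x ∈ LinearMap.range em)
    (Γ : Submodule O M)
    (hΓ0 : Γ = ⨆ j : ℕ, Submodule.torsionBySet O M ((I ^ j : Ideal O) : Set O)) :
    ∃ A : Finset (DiffOp n k r), (A.card : ℕ∞) = Module.length O Γ ∧
      (∀ δ ∈ A, DiffOp.InRelWeylSet S δ) ∧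
      (∀ w, em w = 0 → ∀ δ ∈ A, DiffOp.act δ w ∈ p) ∧
      (∀ w, (∃ j : ℕ, ∀ a ∈ I ^ j, a • em w = 0) →
        (∀ δ ∈ A, DiffOp.act δ w ∈ p) → em w = 0) := by
  obtain ⟨hΓ, m, hm⟩ := dpd_gamma I Γ hΓ0
  have hJI : I ^ (m + 1) ≤ I := Ideal.pow_le_self (by omega)
  let g : (O ⧸ I ^ (m + 1)) →ₐ[MvPolynomial (Fin n) k] F :=
    Ideal.Quotient.liftₐ (I ^ (m + 1)) ρ (fun a ha => (hρI a).2 (hJI ha))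
  have hgmk : ∀ o : O, g (Ideal.Quotient.mk _ o) = ρ o := fun o => rfl
  have hg : Function.Surjective g := by
    intro x
    obtain ⟨o, rfl⟩ := hρ x
    exact ⟨Ideal.Quotient.mk _ o, rfl⟩
  have hker : RingHom.ker g ^ (m + 1) = ⊥ := by
    have h1 : RingHom.ker g ≤ I.map (Ideal.Quotient.mk (I ^ (m + 1))) := by
      intro x hx
      obtain ⟨y, rfl⟩ := Ideal.Quotient.mk_surjective x
      apply Ideal.mem_map_of_mem
      rw [RingHom.mem_ker, hgmk, hρI] at hx
      exact hx
    have h2 := Ideal.pow_right_mono h1 (m + 1)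
    rw [← Ideal.map_pow, Ideal.map_quotient_self] at h2
    exact le_bot_iff.1 h2
  have _ : IsArtinianRing (O ⧸ I ^ (m + 1)) := dpd_artin I hI m
  have _ : IsScalarTower O (O ⧸ I ^ (m + 1)) (M ⧸ (I ^ (m + 1) • ⊤ : Submodule O M)) :=
    ⟨fun a b x => by
      obtain ⟨o, rfl⟩ := Ideal.Quotient.mk_surjective b
      exact mul_smul a o x⟩
  have _ : IsScalarTower (MvPolynomial (Fin n) k) (O ⧸ I ^ (m + 1))
      (M ⧸ (I ^ (m + 1) • ⊤ : Submodule O M)) :=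
    ⟨fun a b x => by
      obtain ⟨o, rfl⟩ := Ideal.Quotient.mk_surjective b
      exact smul_assoc a o x⟩
  obtain ⟨A, h1, h2, h3, h4⟩ := dpd_mid p S hS g hg (m + 1) hker
    (O := O) Ideal.Quotient.mk_surjective em hem
    (I ^ (m + 1) • ⊤ : Submodule O M).mkQ (Submodule.mkQ_surjective _) Γ
    (fun x hx h => hm x hx ((Submodule.Quotient.mk_eq_zero _).1 h))
  exact ⟨A, h1, h2, h3, fun w hw => h4 w ((hΓ _).2 hw)⟩

theorem dpd_local {k : Type*} [Field k] [CharZero k] {n r : ℕ}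
    (p : Ideal (MvPolynomial (Fin n) k)) (hp : p.IsPrime)
    (U : Submodule (MvPolynomial (Fin n) k) (Fin r → MvPolynomial (Fin n) k)) :
    ∃ (S : Finset (Fin n)) (A : Finset (DiffOp n k r)),
      AlgebraicIndependent k
        (fun j : {l : Fin n // l ∈ S} => Ideal.Quotient.mk p (X j.1)) ∧
      p.height + (S.card : ℕ∞) = n ∧
      (∀ δ ∈ A, DiffOp.InRelWeylSet S δ) ∧
      ((A.card : ℕ) : WithBot ℕ∞) =
        satLength p hp ((Fin r → MvPolynomial (Fin n) k) ⧸ U) ∧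
      (∀ w, (∃ s ∉ p, s • w ∈ U) → ∀ δ ∈ A, DiffOp.act δ w ∈ p) ∧
      (∀ w, (∃ j : ℕ, ∀ x ∈ p ^ j, ∃ s ∉ p, s • x • w ∈ U) →
        (∀ δ ∈ A, DiffOp.act δ w ∈ p) → ∃ s ∉ p, s • w ∈ U) := by
  obtain ⟨S, hS, hcard⟩ := dpd_exists_S k n p
  refine ⟨S, ?_⟩
  let R := MvPolynomial (Fin n) k
  let M := (Fin r → R) ⧸ U
  let O := Localization.AtPrime p
  let Mp := LocalizedModule p.primeCompl M
  let I : Ideal O := p.map (algebraMap R O)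
  have hI : I = IsLocalRing.maximalIdeal O := Localization.AtPrime.map_eq_maximalIdeal
  have _ : IsNoetherianRing O := IsLocalization.isNoetherianRing p.primeCompl O inferInstance
  let em : M →ₗ[R] Mp := LocalizedModule.mkLinearMap p.primeCompl M
  have _ : Module.Finite O Mp := Module.Finite.of_isLocalizedModule p.primeCompl em
  have hem : ∀ x : Mp, ∃ s ∉ p, s • x ∈ LinearMap.range (em ∘ₗ U.mkQ) := by
    intro y
    obtain ⟨⟨z, s⟩, hz⟩ := IsLocalizedModule.surj p.primeCompl em y
    obtain ⟨w, rfl⟩ := Submodule.mkQ_surjective _ z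
    exact ⟨s, s.2, w, hz.symm⟩
  obtain ⟨A, hA1, hA2, hA3, hA4⟩ := dpd_mid2 p S hS (F := p.ResidueField) (O := O)
    (IsScalarTower.toAlgHom _ _ _) IsLocalRing.residue_surjective I hI
    (fun x => by rw [hI]; exact IsLocalRing.residue_eq_zero_iff x) (em ∘ₗ U.mkQ) hem _ rfl
  have hzero : ∀ w, em (U.mkQ w) = 0 ↔ ∃ s ∉ p, s • w ∈ U := by
    intro w
    rw [IsLocalizedModule.eq_zero_iff p.primeCompl em]
    constructor
    · rintro ⟨s, hs⟩
      refine ⟨s, s.2, ?_⟩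
      rw [← Submodule.Quotient.mk_eq_zero, Submodule.Quotient.mk_smul]
      exact hs
    · rintro ⟨s, hs, hw⟩
      refine ⟨⟨s, hs⟩, ?_⟩
      rw [← Submodule.Quotient.mk_eq_zero, Submodule.Quotient.mk_smul] at hw
      exact hw
  refine ⟨A, hS.1, hcard, hA2, ?_, ?_, ?_⟩
  · have h2 := congrArg (fun x : ℕ∞ => (x : WithBot ℕ∞)) hA1
    rw [Module.coe_length] at h2
    exact h2
  · intro w hw
    exact hA3 w ((hzero w).2 hw)
  · rintro w ⟨j, hj⟩ hw
    rw [← hzero]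
    refine hA4 w ⟨j, ?_⟩ hw
    have h2 : I ^ j ≤ LinearMap.ker (LinearMap.toSpanSingleton O Mp (em (U.mkQ w))) := by
      rw [← Ideal.map_pow, Ideal.map_le_iff_le_comap]
      intro x hx
      rw [Ideal.mem_comap, LinearMap.mem_ker, LinearMap.toSpanSingleton_apply, algebraMap_smul,
        ← map_smul, ← map_smul, hzero]
      exact hj x hx
    exact fun a ha => h2 ha

theorem dpd_clear {R M : Type*} [CommRing R] [IsNoetherianRing R] [AddCommGroup M] [Module R M]
    (p : Ideal R) [hp : p.IsPrime] (q : Ideal R) (y : M)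
    (h : ∀ a ∈ q, ∃ s ∉ p, s • a • y = 0) : ∃ t ∉ p, ∀ a ∈ q, t • a • y = 0 := by
  classical
  obtain ⟨T, hT⟩ := (IsNoetherian.noetherian q : q.FG)
  have hq : ∀ T : Finset R, (∀ a ∈ T, a ∈ q) → ∃ t ∉ p, ∀ a ∈ T, t • a • y = 0 := by
    intro T
    induction T using Finset.induction_on with
    | empty => exact fun _ => ⟨1, hp.one_notMem, by simp⟩
    | insert a T _ ih =>
      intro hT
      obtain ⟨t, ht, hta⟩ := ih fun b hb => hT b (Finset.mem_insert_of_mem hb)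
      obtain ⟨s, hs, hsa⟩ := h a (hT a (Finset.mem_insert_self _ _))
      refine ⟨t * s, fun hts => (hp.mem_or_mem hts).elim ht hs, fun b hb => ?_⟩
      rcases Finset.mem_insert.1 hb with rfl | hb
      · rw [mul_smul, hsa, smul_zero]
      · rw [mul_comm, mul_smul, hta b hb, smul_zero]
  obtain ⟨t, ht, hta⟩ := hq T fun a ha => hT ▸ Submodule.subset_span ha
  refine ⟨t, ht, ?_⟩
  have h1 : q ≤ (⊥ : Submodule R M).colon {t • y} := by
    rw [← hT, Submodule.span_le]
    intro a ha
    rw [SetLike.mem_coe, Submodule.mem_colon_singleton, Submodule.mem_bot, smul_comm]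
    exact hta a ha
  intro a ha
  have := h1 ha
  rwa [Submodule.mem_colon_singleton, Submodule.mem_bot, smul_comm] at this

theorem dpd_glue {R M : Type*} [CommRing R] [IsNoetherianRing R] [AddCommGroup M] [Module R M]
    (p : Ideal R) [hp : p.IsPrime] (x : M)
    (h : ∀ q ∈ associatedPrimes R M, q < p → ∃ s ∉ q, s • x = 0) :
    ∃ j : ℕ, ∀ a ∈ p ^ j, ∃ s ∉ p, s • a • x = 0 := by
  let W : Submodule R M :=
    { carrier := {y | ∃ s ∉ p, s • y = 0}
      add_mem' := by
        rintro a b ⟨s, hs, hsa⟩ ⟨t, ht, htb⟩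
        refine ⟨s * t, fun h => (hp.mem_or_mem h).elim hs ht, ?_⟩
        rw [smul_add, mul_comm, mul_smul, hsa, mul_comm, mul_smul, htb, smul_zero, smul_zero,
          add_zero]
      zero_mem' := ⟨1, hp.one_notMem, smul_zero _⟩
      smul_mem' := by
        rintro c a ⟨s, hs, hsa⟩
        exact ⟨s, hs, by rw [smul_comm, hsa, smul_zero]⟩ }
  have hW : ∀ y, y ∈ W ↔ ∃ s ∉ p, s • y = 0 := fun y => Iff.rfl
  have hWc : ∀ s y, s ∉ p → s • y ∈ W → y ∈ W := by
    rintro s y hs ⟨t, ht, hty⟩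
    exact ⟨t * s, fun h => (hp.mem_or_mem h).elim ht hs, by rw [mul_smul, hty]⟩
  have hrad : p ≤ (W.colon {x}).radical := by
    rw [← Ideal.sInf_minimalPrimes]
    refine le_sInf fun q hq => ?_
    have hqp : q.IsPrime := hq.1.1
    obtain ⟨y, hy⟩ := Submodule.exists_eq_colon_of_mem_minimalPrimes hq
    have hyW : y ∉ W := by
      intro hyW
      apply hqp.ne_top
      rw [hy, Ideal.eq_top_iff_one, Submodule.mem_colon_singleton, one_smul]
      exact hyW
    have hmem : ∀ a, a ∈ q ↔ a • y ∈ W := by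
      intro a
      rw [hy, Submodule.mem_colon_singleton]
    have hle : q ≤ p := by
      intro a ha
      by_contra hap
      exact hyW (hWc a y hap ((hmem a).1 ha))
    obtain ⟨t, ht, hty⟩ := dpd_clear p q y fun a ha => (hmem a).1 ha
    have hass : q ∈ associatedPrimes R M := by
      rw [AssociatedPrimes.mem_iff, isAssociatedPrime_iff]
      refine ⟨hqp, t • y, ?_⟩
      ext a
      rw [Submodule.mem_colon_singleton, Submodule.mem_bot]
      constructor
      · intro ha
        rw [smul_comm]
        exact hty a ha
      · intro ha
        rw [hmem]
        exact ⟨t, ht, by rw [smul_comm]; exact ha⟩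
    rcases hle.lt_or_eq with hlt | heq
    · obtain ⟨s, hs, hsx⟩ := h q hass hlt
      exfalso
      apply hs
      apply hq.1.2
      rw [Submodule.mem_colon_singleton, hsx]
      exact zero_mem _
    · exact heq.ge
  obtain ⟨j, hj⟩ := Ideal.exists_pow_le_of_le_radical_of_fg hrad (IsNoetherian.noetherian p)
  refine ⟨j, fun a ha => ?_⟩
  have := hj ha
  rwa [Submodule.mem_colon_singleton] at this

theorem stmt13 (n r K : ℕ) (k : Type*) [Field k] [CharZero k]
    (U : Submodule (MvPolynomial (Fin n) k) (Fin r → MvPolynomial (Fin n) k)) (hU : U ≠ ⊤)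
    (P : Fin K → Ideal (MvPolynomial (Fin n) k)) (hPinj : Function.Injective P)
    (hPprime : ∀ i, (P i).IsPrime)
    (hAss : associatedPrimes (MvPolynomial (Fin n) k)
      ((Fin r → MvPolynomial (Fin n) k) ⧸ U) = Set.range P) :
    ∃ (S : Fin K → Finset (Fin n)) (A : Fin K → Finset (DiffOp n k r)),
      (∀ i, AlgebraicIndependent k
        (fun j : {l : Fin n // l ∈ S i} => Ideal.Quotient.mk (P i) (X j.1))) ∧
      (∀ i, Order.height (⟨P i, hPprime i⟩ : PrimeSpectrum (MvPolynomial (Fin n) k)) +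
        ((S i).card : ℕ∞) = (n : ℕ∞)) ∧
      (∀ i, ∀ δ ∈ A i, DiffOp.InRelWeylSet (S i) δ) ∧
      (((∑ i, (A i).card : ℕ) : WithBot ℕ∞) =
        ∑ i, satLength (P i) (hPprime i) ((Fin r → MvPolynomial (Fin n) k) ⧸ U)) ∧
      (∀ p ∈ associatedPrimes (MvPolynomial (Fin n) k)
          ((Fin r → MvPolynomial (Fin n) k) ⧸ U),
        {w : Fin r → MvPolynomial (Fin n) k | ∃ s ∉ p, s • w ∈ U} =
          ⋂ (i : Fin K) (_ : P i ≤ p),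
            {w : Fin r → MvPolynomial (Fin n) k | ∀ δ ∈ A i, DiffOp.act δ w ∈ P i}) ∧
      ((U : Set (Fin r → MvPolynomial (Fin n) k)) =
        {w : Fin r → MvPolynomial (Fin n) k |
          ∀ i : Fin K, ∀ δ ∈ A i, DiffOp.act δ w ∈ P i}) := by
  classical
  choose S A hS hht hW hlen ha hb using fun i => dpd_local (P i) (hPprime i) U
  have hQ : ∀ (s : MvPolynomial (Fin n) k) (w : Fin r → MvPolynomial (Fin n) k), s • w ∈ U ↔ s • (U.mkQ w) = 0 := by
    intro s w
    rw [← map_smul, Submodule.mkQ_apply, Submodule.Quotient.mk_eq_zero]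
  have hsub : ∀ (p q : Ideal (MvPolynomial (Fin n) k)) (w : Fin r → MvPolynomial (Fin n) k), q ≤ p →
      (∃ s ∉ p, s • w ∈ U) → ∃ s ∉ q, s • w ∈ U := by
    rintro p q w hqp ⟨s, hs, hsw⟩
    exact ⟨s, fun h => hs (hqp h), hsw⟩
  have hmain : ∀ p ∈ associatedPrimes (MvPolynomial (Fin n) k)
      ((Fin r → MvPolynomial (Fin n) k) ⧸ U), ∀ w : Fin r → MvPolynomial (Fin n) k,
      (∀ i, P i ≤ p → ∀ δ ∈ A i, DiffOp.act δ w ∈ P i) → ∃ s ∉ p, s • w ∈ U := by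
    have hK : ∀ N : ℕ, ∀ i : Fin K, (Finset.univ.filter fun l => P l < P i).card < N →
        ∀ w : Fin r → MvPolynomial (Fin n) k,
        (∀ l, P l ≤ P i → ∀ δ ∈ A l, DiffOp.act δ w ∈ P l) → ∃ s ∉ P i, s • w ∈ U := by
      intro N
      induction N with
      | zero => intro i hi; omega
      | succ N ih =>
        intro i hi w hw
        have _ := hPprime i
        obtain ⟨j, hj⟩ := dpd_glue (P i) (U.mkQ w) (by
          intro q hq hlt
          rw [hAss] at hq
          obtain ⟨l, rfl⟩ := hq
          simp only [← hQ]
          refine ih l (lt_of_lt_of_le (Finset.card_lt_card ?_) (Nat.lt_succ_iff.1 hi)) w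
            fun l' hl' => hw l' (hl'.trans hlt.le)
          refine Finset.ssubset_iff_of_subset ?_ |>.2 ⟨l, ?_, ?_⟩
          · intro l' hl'
            simp only [Finset.mem_filter, Finset.mem_univ, true_and] at hl' ⊢
            exact hl'.trans hlt
          · simpa using hlt
          · simp)
        refine hb i w ⟨j, fun x hx => ?_⟩ (hw i le_rfl)
        obtain ⟨s, hs, h⟩ := hj x hx
        refine ⟨s, hs, ?_⟩
        rw [hQ, map_smul]
        exact h
    intro p hp w hw
    rw [hAss] at hp
    obtain ⟨i, rfl⟩ := hp
    exact hK _ i (Nat.lt_succ_self _) w hw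
  refine ⟨S, A, hS, ?_, hW, ?_, ?_, ?_⟩
  · intro i
    have _ := hPprime i
    rw [← hht i, ← PrimeSpectrum.height_eq_orderHeight]
  · rw [← Finset.sum_congr rfl fun i _ => hlen i]
    push_cast
    rfl
  · intro p hp
    ext w
    simp only [Set.mem_setOf_eq, Set.mem_iInter]
    constructor
    · intro h i hi
      exact ha i w (hsub p (P i) w hi h)
    · exact hmain p hp w
  · ext w
    simp only [SetLike.mem_coe, Set.mem_setOf_eq]
    constructor
    · intro h i
      exact ha i w ⟨1, (hPprime i).one_notMem, by rwa [one_smul]⟩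
    · intro h
      by_contra hwU
      have hne : U.mkQ w ≠ 0 := by
        rwa [Ne, Submodule.mkQ_apply, Submodule.Quotient.mk_eq_zero]
      obtain ⟨p, hp, hle⟩ := exists_le_isAssociatedPrime_of_isNoetherianRing
        (MvPolynomial (Fin n) k) (U.mkQ w) hne
      obtain ⟨s, hs, hsw⟩ := hmain p hp w fun i _ => h i
      apply hs
      apply hle
      rw [Submodule.mem_colon_singleton, Submodule.mem_bot, ← hQ]
      exact hsw
end
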